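/- arXiv:2111.14410 — 2 statements merged into one kernel-verified Lean document; each statement's English description precedes it below -/
import Mathlib

section
/- Let n ≥ 2 and let h ∈ ℂ[X₀,…,Xₙ] be an irreducible homogeneous polynomial of degree d defining a hypersurface X = {h = 0} ⊂ ℙⁿ(ℂ) that is totally invariant under a non-trivial endomorphism of ℙⁿ. Let l be the dimension of the singular locus of X (with l = −1 if X is smooth), i.e. the Jacobian ring J(h) has Krull dimension l + 1 (resp. Krull dimension ≤ 0 when l = −1). Then (d − 1)^(n − l − 1) < binom(n, l + 1). -/
open MvPolynomial

/-- `F` is an endomorphism of `ℙ^{N-1}(ℂ)` of algebraic degree `q`: a tuple of `N`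
homogeneous polynomials of degree `q` in `N` variables whose only common zero in `ℂ^N`
is the origin. -/
def IsEndo (N q : ℕ) (F : Fin N → MvPolynomial (Fin N) ℂ) : Prop :=
  (∀ i, (F i).IsHomogeneous q) ∧
    ∀ x : Fin N → ℂ, (∀ i, eval x (F i) = 0) → x = 0

/-- The hypersurface `{h = 0} ⊂ ℙ^{N-1}(ℂ)` is totally invariant: there is a non-trivial
endomorphism `F` (of algebraic degree `q ≥ 2`) and `λ ≠ 0` with `h(F₀,…,F_{N-1}) = λ·h^q`. -/
def IsTotallyInvariant (N : ℕ) (h : MvPolynomial (Fin N) ℂ) : Prop :=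
  ∃ q, 2 ≤ q ∧ ∃ F : Fin N → MvPolynomial (Fin N) ℂ, IsEndo N q F ∧
    ∃ lam : ℂ, lam ≠ 0 ∧ aeval F h = C lam * h ^ q

/-- The Jacobian ideal `(h, ∂h/∂X₀, …, ∂h/∂X_{N-1})`. -/
noncomputable def jacobianIdeal (N : ℕ) (h : MvPolynomial (Fin N) ℂ) : Ideal (MvPolynomial (Fin N) ℂ) :=
  Ideal.span (insert h (Set.range fun i => pderiv i h))

section
open RingTheory.Sequence

lemma cme_avoid {S : Type*} [CommRing S] [IsLocalRing S] [IsNoetherianRing S] (I : Ideal S) (a : S)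
    (h : IsLocalRing.maximalIdeal S ≤ (I ⊔ Ideal.span {a}).radical) (ha : a ∈ IsLocalRing.maximalIdeal S)
    (g : S) (hg : ∀ P ∈ I.minimalPrimes, P ≠ IsLocalRing.maximalIdeal S → g ∉ P) :
    IsLocalRing.maximalIdeal S ≤ (I ⊔ Ideal.span {g}).radical := by
  rw [Ideal.radical_eq_sInf]
  refine le_sInf ?_
  rintro Q ⟨hQ, hQp⟩
  by_contra hne
  have hIQ : I ≤ Q := le_sup_left.trans hQ
  have hgQ : g ∈ Q := hQ (Ideal.mem_sup_right (Ideal.mem_span_singleton_self g))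
  have hQm : Q < IsLocalRing.maximalIdeal S :=
    lt_of_le_not_ge (IsLocalRing.le_maximalIdeal hQp.ne_top) hne
  obtain ⟨P, hP, hPQ⟩ := Ideal.exists_minimalPrimes_le hIQ
  have hPp : P.IsPrime := hP.1.1
  have hPm : P < IsLocalRing.maximalIdeal S := lt_of_le_of_lt hPQ hQm
  have hgP := hg P hP hPm.ne
  have hPQ' : P < Q := lt_of_le_of_ne hPQ (fun e => hgP (e ▸ hgQ))
  let f := Ideal.Quotient.mk P
  have hf : Function.Surjective f := Ideal.Quotient.mk_surjective
  have hkm : RingHom.ker f ≤ IsLocalRing.maximalIdeal S := by rw [Ideal.mk_ker]; exact hPm.le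
  have hkQ : RingHom.ker f ≤ Q := by rw [Ideal.mk_ker]; exact hPQ
  have p1 : (Ideal.map f (IsLocalRing.maximalIdeal S)).IsPrime := Ideal.map_isPrime_of_surjective hf hkm
  have p2 : (Ideal.map f Q).IsPrime := Ideal.map_isPrime_of_surjective hf hkQ
  have c1 : Ideal.comap f (Ideal.map f (IsLocalRing.maximalIdeal S)) = IsLocalRing.maximalIdeal S := by
    rw [Ideal.comap_map_of_surjective' f hf, sup_eq_left.2 hkm]
  have c2 : Ideal.comap f (Ideal.map f Q) = Q := by
    rw [Ideal.comap_map_of_surjective' f hf, sup_eq_left.2 hkQ]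
  have l1 : Ideal.map f Q < Ideal.map f (IsLocalRing.maximalIdeal S) := by
    refine lt_of_le_of_ne (Ideal.map_mono hQm.le) fun e => ?_
    rw [e, c1] at c2
    exact hQm.ne c2.symm
  have l0 : (⊥ : Ideal (S ⧸ P)) < Ideal.map f Q := by
    refine bot_lt_iff_ne_bot.2 fun e => ?_
    rw [e] at c2
    apply hPQ'.ne
    rw [← c2, ← RingHom.ker_eq_comap_bot, Ideal.mk_ker]
  have hb : (⊥ : Ideal (S ⧸ P)).IsPrime := Ideal.isPrime_bot
  have hh := Ideal.height_add_one_le_of_lt_of_isPrime l0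
  have hh' := Ideal.height_add_one_le_of_lt_of_isPrime l1
  have hmin : Ideal.map f (IsLocalRing.maximalIdeal S) ∈ (Ideal.span {f a}).minimalPrimes := by
    refine ⟨⟨p1, ?_⟩, ?_⟩
    · rw [Ideal.span_singleton_le_iff_mem]; exact Ideal.mem_map_of_mem f ha
    · rintro J ⟨hJ, hJa⟩ _
      rw [Ideal.map_le_iff_le_comap]
      refine h.trans ?_
      have : (Ideal.comap f J).IsPrime := Ideal.comap_isPrime f J
      rw [this.radical_le_iff]
      refine sup_le ?_ ?_
      · refine hP.1.2.trans ?_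
        intro x hx
        rw [Ideal.mem_comap]
        have : f x = 0 := Ideal.Quotient.eq_zero_iff_mem.2 hx
        rw [this]; exact J.zero_mem
      · rw [Ideal.span_singleton_le_iff_mem, Ideal.mem_comap]
        exact hJa (Ideal.mem_span_singleton_self _)
  have := Ideal.height_le_one_of_isPrincipal_of_mem_minimalPrimes (Ideal.span {f a}) _ hmin
  have h2 : (0:ℕ∞) + 1 + 1 ≤ 1 := by
    calc (0:ℕ∞) + 1 + 1 ≤ (⊥ : Ideal (S ⧸ P)).height + 1 + 1 := by gcongr; exact zero_le
      _ ≤ _ := by gcongr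
      _ ≤ _ := hh'
      _ ≤ 1 := this
  norm_num at h2

lemma cme_trick {S : Type*} [CommRing S] (l : List S) (a g : S)
    (hr : IsWeaklyRegular S (l ++ [a])) (h : a ∈ (Ideal.ofList l ⊔ Ideal.span {g}).radical) :
    IsWeaklyRegular S (l ++ [g]) := by
  rw [isWeaklyRegular_append_iff, isWeaklyRegular_singleton_iff] at hr ⊢
  refine ⟨hr.1, ?_⟩
  obtain ⟨k, hk⟩ := h
  obtain ⟨i, hi, j, hj, hij⟩ := Submodule.mem_sup.1 hk
  obtain ⟨c, rfl⟩ := Ideal.mem_span_singleton'.1 hj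
  have hreg := hr.2.pow k
  intro u v huv
  apply hreg
  induction u using Submodule.Quotient.induction_on with | _ u
  induction v using Submodule.Quotient.induction_on with | _ v
  simp only [← Submodule.Quotient.mk_smul, Submodule.Quotient.eq, smul_eq_mul, Ideal.mul_top] at huv ⊢
  have : a ^ k * u - a ^ k * v = i * (u - v) + c * (g * u - g * v) := by rw [← hij]; ring
  rw [this]
  exact Ideal.add_mem _ (Ideal.mul_mem_right _ _ hi) (Ideal.mul_mem_left _ _ huv)

lemma cme_quot {S : Type*} [CommRing S] (g : S) (l : List S) :
    IsWeaklyRegular S (g :: l) ↔ IsSMulRegular S g ∧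
      IsWeaklyRegular (S ⧸ Ideal.span {g}) (l.map (Ideal.Quotient.mk (Ideal.span {g}))) := by
  rw [isWeaklyRegular_cons_iff]
  refine and_congr_right' ?_
  have e : QuotSMulTop g S ≃ₗ[S] (S ⧸ Ideal.span {g}) :=
    Submodule.quotEquivOfEq _ _ (by
      rw [← Submodule.ideal_span_singleton_smul]; simp)
  rw [e.isWeaklyRegular_congr]
  exact (isWeaklyRegular_map_algebraMap_iff (S ⧸ Ideal.span {g}) _ l).symm

theorem cme.{u} (n : ℕ) : ∀ (S : Type u) [CommRing S] [IsLocalRing S] [IsNoetherianRing S] (xs fs : List S),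
    xs.length = n → fs.length = n →
    (∀ x ∈ xs, x ∈ IsLocalRing.maximalIdeal S) → (∀ x ∈ fs, x ∈ IsLocalRing.maximalIdeal S) →
    IsLocalRing.maximalIdeal S ≤ (Ideal.ofList xs).radical →
    IsLocalRing.maximalIdeal S ≤ (Ideal.ofList fs).radical →
    IsWeaklyRegular S xs → IsWeaklyRegular S fs := by
  induction n with
  | zero =>
    intro S _ _ _ xs fs _ hf _ _ _ _ _
    rw [List.length_eq_zero_iff.1 hf]
    exact IsWeaklyRegular.nil _ _
  | succ n ih =>
    intro S _ _ _ xs fs hx hf mx mf rx rf hreg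
    obtain ⟨xs, a, rfl⟩ := List.eq_nil_or_concat' xs |>.resolve_left (by rintro rfl; simp at hx)
    obtain ⟨fs, b, rfl⟩ := List.eq_nil_or_concat' fs |>.resolve_left (by rintro rfl; simp at hf)
    simp only [List.length_append, List.length_singleton, add_left_inj] at hx hf
    simp only [List.mem_append, List.mem_singleton] at mx mf
    rw [Ideal.ofList_append, Ideal.ofList_singleton] at rx rf
    obtain ⟨g, hgm, hg1, hg2⟩ : ∃ g ∈ IsLocalRing.maximalIdeal S,
        (∀ P ∈ (Ideal.ofList xs).minimalPrimes, P ≠ IsLocalRing.maximalIdeal S → g ∉ P) ∧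
        (∀ P ∈ (Ideal.ofList fs).minimalPrimes, P ≠ IsLocalRing.maximalIdeal S → g ∉ P) := by
      have hfin : (((Ideal.ofList xs).minimalPrimes ∪ (Ideal.ofList fs).minimalPrimes) \
          {IsLocalRing.maximalIdeal S}).Finite :=
        ((Ideal.finite_minimalPrimes_of_isNoetherianRing S _).union
          (Ideal.finite_minimalPrimes_of_isNoetherianRing S _)).diff
      by_contra hcon
      push Not at hcon
      have hp : ∀ P ∈ hfin.toFinset, P.IsPrime := by
        intro P hP
        rw [Set.Finite.mem_toFinset] at hP
        rcases hP.1 with h | h <;> exact h.1.1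
      have := (Ideal.subset_union_prime (s := hfin.toFinset) (f := fun P => P) ⊤ ⊤
        (fun i hi _ _ => hp i hi) (I := IsLocalRing.maximalIdeal S)).1 (by
          intro g hg
          simp only [Set.mem_iUnion]
          by_cases h1 : ∀ P ∈ (Ideal.ofList xs).minimalPrimes, P ≠ IsLocalRing.maximalIdeal S → g ∉ P
          · obtain ⟨P, hP, hP', hgP⟩ := hcon g hg h1
            exact ⟨P, by simp [hP, hP'], hgP⟩
          · push Not at h1
            obtain ⟨P, hP, hP', hgP⟩ := h1
            exact ⟨P, by simp [hP, hP'], hgP⟩)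
      obtain ⟨P, hP, hle⟩ := this
      have hpp := hp P hP
      rw [Set.Finite.mem_toFinset] at hP
      exact hP.2 (le_antisymm (IsLocalRing.le_maximalIdeal hpp.ne_top) hle)
    have ham := mx a (Or.inr rfl)
    have hbm := mf b (Or.inr rfl)
    have r1 := cme_avoid _ a rx ham g hg1
    have r2 := cme_avoid _ b rf hbm g hg2
    have hreg1 := cme_trick xs a g hreg (r1 ham)
    have mem1 : ∀ r ∈ xs ++ [g], r ∈ IsLocalRing.maximalIdeal S := by
      intro r hr
      simp only [List.mem_append, List.mem_singleton] at hr
      rcases hr with h | rfl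
      · exact mx r (Or.inl h)
      · exact hgm
    have hreg2 := IsLocalRing.isWeaklyRegular_of_perm_of_subset_maximalIdeal hreg1
      (rs' := g :: xs) (List.perm_append_singleton g xs) mem1
    rw [cme_quot] at hreg2
    have hne : Ideal.span {g} ≠ ⊤ := by
      intro e
      have : Ideal.span {g} ≤ IsLocalRing.maximalIdeal S := by
        rwa [Ideal.span_singleton_le_iff_mem]
      rw [e] at this
      exact (IsLocalRing.maximalIdeal.isMaximal S).ne_top (top_le_iff.1 this)
    have : Nontrivial (S ⧸ Ideal.span {g}) := Ideal.Quotient.nontrivial_iff.2 hne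
    have : IsLocalRing (S ⧸ Ideal.span {g}) := IsLocalRing.of_surjective' _ Ideal.Quotient.mk_surjective
    have hloc : ∀ x, x ∈ IsLocalRing.maximalIdeal S →
        Ideal.Quotient.mk (Ideal.span {g}) x ∈ IsLocalRing.maximalIdeal (S ⧸ Ideal.span {g}) := by
      intro x hx
      rw [IsLocalRing.mem_maximalIdeal, mem_nonunits_iff] at hx ⊢
      have : IsLocalHom (Ideal.Quotient.mk (Ideal.span {g})) := IsLocalHom.of_surjective _ Ideal.Quotient.mk_surjective
      intro hu
      exact hx (isUnit_of_map_unit _ _ hu)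
    have hrad : ∀ l : List S, IsLocalRing.maximalIdeal S ≤ (Ideal.ofList l ⊔ Ideal.span {g}).radical →
        IsLocalRing.maximalIdeal (S ⧸ Ideal.span {g}) ≤
        (Ideal.ofList (l.map (Ideal.Quotient.mk (Ideal.span {g})))).radical := by
      intro l hl x hx
      obtain ⟨x, rfl⟩ := Ideal.Quotient.mk_surjective x
      have hx' : x ∈ IsLocalRing.maximalIdeal S := by
        rw [IsLocalRing.mem_maximalIdeal, mem_nonunits_iff] at hx ⊢
        exact fun hu => hx (hu.map _)
      obtain ⟨k, hk⟩ := hl hx'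
      obtain ⟨i, hi, j, hj, hij⟩ := Submodule.mem_sup.1 hk
      refine ⟨k, ?_⟩
      rw [← map_pow, ← hij, map_add, Ideal.Quotient.eq_zero_iff_mem.2 hj, add_zero, ← Ideal.map_ofList]
      exact Ideal.mem_map_of_mem _ hi
    have hreg3 := ih (S ⧸ Ideal.span {g}) (xs.map (Ideal.Quotient.mk _)) (fs.map (Ideal.Quotient.mk _))
      (by simpa using hx) (by simpa using hf)
      (by intro x hx; obtain ⟨y, hy, rfl⟩ := List.mem_map.1 hx; exact hloc y (mx y (Or.inl hy)))
      (by intro x hx; obtain ⟨y, hy, rfl⟩ := List.mem_map.1 hx; exact hloc y (mf y (Or.inl hy)))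
      (hrad _ r1) (hrad _ r2) hreg2.2
    have hreg4 := (cme_quot g fs).2 ⟨hreg2.1, hreg3⟩
    have hreg5 := IsLocalRing.isWeaklyRegular_of_perm_of_subset_maximalIdeal hreg4
      (rs' := fs ++ [g]) (List.perm_append_singleton g fs).symm (by
        intro r hr
        rcases List.mem_cons.1 hr with rfl | h
        · exact hgm
        · exact mf r (Or.inl h))
    exact cme_trick fs g b hreg5 (rf hgm)

theorem free_of_reg.{u, v} (n : ℕ) : ∀ (A : Type u) [CommRing A] [IsLocalRing A] [IsNoetherianRing A]
    (M : Type v) [AddCommGroup M] [Module A M] [Module.Finite A M] (ys : List A), ys.length = n →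
    IsLocalRing.maximalIdeal A = Ideal.ofList ys → IsWeaklyRegular M ys → Module.Free A M := by
  induction n with
  | zero =>
    intro A _ _ _ M _ _ _ ys hl hm _
    rw [List.length_eq_zero_iff.1 hl, Ideal.ofList_nil] at hm
    have hF : IsField A := IsLocalRing.isField_iff_maximalIdeal_eq.2 hm
    letI := hF.toField
    exact Module.Free.of_divisionRing A M
  | succ n ih =>
    intro A _ _ _ M _ _ _ ys hl hm hreg
    cases ys with
    | nil => simp at hl
    | cons y ys =>
    rw [isWeaklyRegular_cons_iff'] at hreg
    have hym : y ∈ IsLocalRing.maximalIdeal A := by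
      rw [hm]; exact Ideal.subset_span (by simp)
    have hne : Ideal.span {y} ≠ ⊤ := by
      intro e
      have : Ideal.span {y} ≤ IsLocalRing.maximalIdeal A := by
        rwa [Ideal.span_singleton_le_iff_mem]
      rw [e] at this
      exact (IsLocalRing.maximalIdeal.isMaximal A).ne_top (top_le_iff.1 this)
    have : Nontrivial (A ⧸ Ideal.span {y}) := Ideal.Quotient.nontrivial_iff.2 hne
    have : IsLocalRing (A ⧸ Ideal.span {y}) := IsLocalRing.of_surjective' _ Ideal.Quotient.mk_surjective
    have : Module.Finite (A ⧸ Ideal.span {y}) (QuotSMulTop y M) :=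
      Module.Finite.of_restrictScalars_finite A _ _
    have hp : Module.FinitePresentation A M := Module.finitePresentation_of_finite A M
    rw [← Module.free_quotSMulTop_iff_free A M (x := y) (by rw [IsLocalRing.jacobson_eq_maximalIdeal _ bot_ne_top]; exact hym) hreg.1]
    refine ih _ _ (ys.map (Ideal.Quotient.mk _)) (by simpa using hl) ?_ hreg.2
    rw [← Ideal.map_ofList]
    apply le_antisymm
    · intro x hx
      obtain ⟨x, rfl⟩ := Ideal.Quotient.mk_surjective x
      have hx' : x ∈ IsLocalRing.maximalIdeal A := by
        rw [IsLocalRing.mem_maximalIdeal, mem_nonunits_iff] at hx ⊢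
        exact fun hu => hx (hu.map _)
      rw [hm, Ideal.ofList_cons] at hx'
      obtain ⟨i, hi, j, hj, hij⟩ := Submodule.mem_sup.1 hx'
      rw [← hij, map_add, Ideal.Quotient.eq_zero_iff_mem.2 hi, zero_add]
      exact Ideal.mem_map_of_mem _ hj
    · rw [Ideal.map_le_iff_le_comap]
      intro x hx
      have hx' : x ∈ IsLocalRing.maximalIdeal A := by
        rw [hm, Ideal.ofList_cons]; exact Ideal.mem_sup_right hx
      rw [Ideal.mem_comap, IsLocalRing.mem_maximalIdeal, mem_nonunits_iff]
      have : IsLocalHom (Ideal.Quotient.mk (Ideal.span {y})) := IsLocalHom.of_surjective _ Ideal.Quotient.mk_surjective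
      intro hu
      exact hx' (isUnit_of_map_unit _ _ hu)
end

section
open RingTheory.Sequence

set_option maxHeartbeats 1000000 in
lemma flat_abs {A R : Type} [CommRing A] [CommRing R] [IsNoetherianRing A] [IsNoetherianRing R]
    (φ : A →+* R) (hφ : φ.Finite) (m : Ideal A) [hm : m.IsMaximal] (mR : Ideal R) [hmR : mR.IsMaximal]
    (ys : List A) (xs : List R) (hlen : xs.length = ys.length) (hys : m = Ideal.ofList ys)
    (hxs : mR = Ideal.ofList xs) (hreg : IsWeaklyRegular R xs)
    (hle : m.map φ ≤ mR) (hrad : mR ≤ (m.map φ).radical)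
    {ι : Type} [Fintype ι] (w : ι → R) (p : ι → A) (hw : ∑ j, φ (p j) * w j = 0) :
    ∃ (s : A) (k : ℕ) (a : ι → Fin k → A) (y : Fin k → R), s ∉ m ∧
      (∀ i, φ s * w i = ∑ j, φ (a i j) * y j) ∧ ∀ j, ∑ i, p i * a i j = 0 := by
  let _ : Algebra A R := φ.toAlgebra
  have hfin : Module.Finite A R := hφ
  have hmp : m.IsPrime := hm.isPrime
  let Am := Localization.AtPrime m
  let T := Algebra.algebraMapSubmonoid R m.primeCompl
  let Rm := Localization T
  have hfin' : Module.Finite Am Rm := Module.Finite.of_isLocalization A R m.primeCompl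
  have hnR : IsNoetherianRing Rm := IsLocalization.isNoetherianRing T Rm inferInstance
  have hnA : IsNoetherianRing Am := IsLocalization.isNoetherianRing m.primeCompl Am inferInstance
  have hmapA : Ideal.map (algebraMap A Am) m = IsLocalRing.maximalIdeal Am :=
    Localization.AtPrime.map_eq_maximalIdeal
  -- every maximal ideal
  have key : ∀ P : Ideal Rm, P.IsMaximal → P = mR.map (algebraMap R Rm) := by
    intro P hP
    have h1 : (Ideal.comap (algebraMap Am Rm) P).IsMaximal :=
      Ideal.isMaximal_comap_of_isIntegral_of_isMaximal P
    have h2 : Ideal.comap (algebraMap Am Rm) P = IsLocalRing.maximalIdeal Am :=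
      IsLocalRing.eq_maximalIdeal h1
    have h3 : (m.map φ) ≤ P.comap (algebraMap R Rm) := by
      rw [Ideal.map_le_iff_le_comap]
      intro a ha
      have : algebraMap A Am a ∈ Ideal.comap (algebraMap Am Rm) P := by
        rw [h2, ← hmapA]; exact Ideal.mem_map_of_mem _ ha
      rw [Ideal.mem_comap, ← IsScalarTower.algebraMap_apply, IsScalarTower.algebraMap_apply A R Rm] at this
      exact this
    have hPp : (P.comap (algebraMap R Rm)).IsPrime := Ideal.comap_isPrime _ _
    have h4 : mR ≤ P.comap (algebraMap R Rm) :=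
      hrad.trans (hPp.isRadical.radical_le_iff.mpr h3)
    have h5 : mR = P.comap (algebraMap R Rm) := hmR.eq_of_le hPp.ne_top h4
    rw [h5]; exact (IsLocalization.map_under T Rm P).symm
  have hnt : Nontrivial Rm := by
    rw [← not_subsingleton_iff_nontrivial, IsLocalization.subsingleton_iff (M := T) (S := Rm)]
    rintro ⟨a, ha, ha0⟩
    have hc : m = mR.comap φ := hm.eq_of_le (Ideal.comap_ne_top φ hmR.ne_top)
      (Ideal.map_le_iff_le_comap.mp hle)
    have : a ∈ m := by
      rw [hc, Ideal.mem_comap]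
      have e : φ a = 0 := ha0
      rw [e]; exact mR.zero_mem
    exact ha this
  obtain ⟨P0, hP0⟩ := Ideal.exists_maximal Rm
  have hloc : IsLocalRing Rm := IsLocalRing.of_unique_max_ideal
    ⟨P0, hP0, fun P hP => (key P hP).trans (key P0 hP0).symm⟩
  have hmax : IsLocalRing.maximalIdeal Rm = mR.map (algebraMap R Rm) :=
    key _ (IsLocalRing.maximalIdeal.isMaximal Rm)
  have hregx : IsWeaklyRegular Rm (xs.map (algebraMap R Rm)) := hreg.of_isLocalization Rm T
  have hmx : IsLocalRing.maximalIdeal Rm = Ideal.ofList (xs.map (algebraMap R Rm)) := by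
    rw [hmax, hxs, Ideal.map_ofList]
  have hyl : (Ideal.ofList (ys.map (algebraMap A Rm))) = (m.map φ).map (algebraMap R Rm) := by
    rw [← Ideal.map_ofList, ← hys, Ideal.map_map]; rfl
  have hmf : IsLocalRing.maximalIdeal Rm ≤ (Ideal.ofList (ys.map (algebraMap A Rm))).radical := by
    rw [hyl, hmax]
    refine (Ideal.map_mono hrad).trans (Ideal.map_radical_le _)
  have hregf : IsWeaklyRegular Rm (ys.map (algebraMap A Rm)) := by
    refine cme ys.length Rm (xs.map (algebraMap R Rm)) (ys.map (algebraMap A Rm)) (by simpa using hlen)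
      (by simp) ?_ ?_ ?_ hmf hregx
    · intro x hx; rw [hmx]; exact Ideal.subset_span hx
    · intro x hx
      have : x ∈ Ideal.ofList (ys.map (algebraMap A Rm)) := Ideal.subset_span hx
      rw [hyl] at this
      rw [hmax]
      exact Ideal.map_mono hle this
    · rw [hmx]; exact Ideal.le_radical
  have hregA : IsWeaklyRegular Rm (ys.map (algebraMap A Am)) := by
    rw [isWeaklyRegular_map_algebraMap_iff]
    rwa [isWeaklyRegular_map_algebraMap_iff] at hregf
  have hfree : Module.Free Am Rm := by
    refine free_of_reg ys.length Am Rm (ys.map (algebraMap A Am)) (by simp) ?_ hregA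
    rw [← hmapA, ← Ideal.map_ofList, ← hys]
  have hflat1 : Module.Flat A Am := IsLocalization.flat Am m.primeCompl
  have hflat : Module.Flat A Rm := Module.Flat.trans A Am Rm
  have hrel : ∑ j, p j • algebraMap R Rm (w j) = 0 := by
    rw [← map_zero (algebraMap R Rm), ← hw, map_sum]
    refine Finset.sum_congr rfl fun j _ => ?_
    rw [map_mul, Algebra.smul_def, IsScalarTower.algebraMap_apply A R Rm]; rfl
  obtain ⟨k, a, y, h1, h2⟩ :=
    Module.Flat.isTrivialRelation_of_sum_smul_eq_zero (R := A) (M := Rm) (f := p)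
      (x := fun j => algebraMap R Rm (w j)) hrel
  classical
  replace h1 : ∀ i, algebraMap R Rm (w i) = ∑ j, a i j • y j := h1
  obtain ⟨⟨b, b', hb', hbb⟩, hb⟩ := IsLocalization.exist_integer_multiples_of_finset T (Finset.univ.image y)
  have hb2 : ∀ j, ∃ z : R, algebraMap R Rm z = algebraMap R Rm b * y j := by
    intro j
    obtain ⟨z, hz⟩ := hb (y j) (by simp)
    exact ⟨z, by rw [hz]; simp [Algebra.smul_def]⟩
  choose z hz using hb2
  have h3 : ∀ i, ∃ c : A, c ∉ m ∧ φ c * (φ b' * w i) = φ c * ∑ j, φ (a i j) * z j := by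
    intro i
    have : algebraMap R Rm (φ b' * w i) = algebraMap R Rm (∑ j, φ (a i j) * z j) := by
      have e : φ b' = b := hbb
      rw [map_mul, h1, e, Finset.mul_sum, map_sum]
      refine Finset.sum_congr rfl fun j _ => ?_
      rw [map_mul, hz, Algebra.smul_def, IsScalarTower.algebraMap_apply A R Rm]
      change _ * (algebraMap R Rm (φ _) * _) = _
      ring
    obtain ⟨⟨c, c', hc', hcc⟩, hc⟩ := (IsLocalization.eq_iff_exists T Rm).mp this
    refine ⟨c', hc', ?_⟩
    have e : φ c' = c := hcc
    rw [e]; exact hc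
  choose c hc h4 using h3
  refine ⟨(∏ i, c i) * b', k, a, fun j => φ (∏ i, c i) * z j, ?_, ?_, h2⟩
  · intro hmem
    rcases hmp.mem_or_mem hmem with h | h
    · obtain ⟨i, _, hi⟩ := (Ideal.IsPrime.prod_mem_iff).mp h
      exact hc i hi
    · exact hb' h
  · intro i
    classical
    rw [← Finset.mul_prod_erase _ c (Finset.mem_univ i)]
    have := h4 i
    simp only [map_mul]
    calc _ = φ (∏ x ∈ Finset.univ.erase i, c x) * (φ (c i) * (φ b' * w i)) := by ring
      _ = _ := by
        rw [this, Finset.mul_sum, Finset.mul_sum]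
        refine Finset.sum_congr rfl fun j _ => ?_
        ring
end

section
open RingTheory.Sequence MvPolynomial


lemma X_weakreg (N : ℕ) : IsWeaklyRegular (MvPolynomial (Fin N) ℂ) (List.ofFn (X : Fin N → MvPolynomial (Fin N) ℂ)) := by
  rw [isWeaklyRegular_iff]
  intro i hi
  have hi' : i < N := by simpa using hi
  have hI : Ideal.ofList (List.take i (List.ofFn (X : Fin N → MvPolynomial (Fin N) ℂ))) =
    Ideal.span (X '' {j : Fin N | j.1 < i}) := by
    unfold Ideal.ofList
    congr 1
    ext p
    simp only [Set.mem_ofPred_eq, List.mem_take_iff_getElem, List.getElem_ofFn, Set.mem_image]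
    constructor
    · rintro ⟨j, hj, rfl⟩
      simp at hj
      exact ⟨⟨j, by omega⟩, by simpa using hj.1, rfl⟩
    · rintro ⟨j, hj, rfl⟩
      exact ⟨j, by simp; omega, rfl⟩
  rw [isSMulRegular_quotient_iff_mem_of_smul_mem]
  intro f hf
  rw [hI, smul_eq_mul, Ideal.mul_top] at hf ⊢
  rw [mem_ideal_span_X_image] at hf ⊢
  intro m hm
  obtain ⟨j, hj, hmj⟩ := hf (Finsupp.single ⟨i, hi'⟩ 1 + m) (by
    rw [List.getElem_ofFn, smul_eq_mul, support_X_mul]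
    simpa using hm)
  refine ⟨j, hj, ?_⟩
  rw [Finsupp.add_apply, Finsupp.single_apply, if_neg] at hmj
  · simpa using hmj
  · rintro rfl
    simp at hj

lemma hc_mul {N q : ℕ} {F : MvPolynomial (Fin N) ℂ} (hF : F.IsHomogeneous q) (g : MvPolynomial (Fin N) ℂ)
    (D : ℕ) : homogeneousComponent D (F * g) = if q ≤ D then F * homogeneousComponent (D - q) g else 0 := by
  conv_lhs => rw [← sum_homogeneousComponent g, Finset.mul_sum, map_sum]
  have : ∀ i, homogeneousComponent D (F * homogeneousComponent i g) =
      if q + i = D then F * homogeneousComponent i g else 0 := by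
    intro i
    rw [homogeneousComponent_of_mem (hF.mul (homogeneousComponent_isHomogeneous i g))]
    simp [eq_comm]
  simp_rw [this]
  split_ifs with hq
  · rw [Finset.sum_eq_single (D - q)]
    · rw [if_pos (by omega)]
    · intro b _ hb
      rw [if_neg (by omega)]
    · intro hb
      rw [homogeneousComponent_eq_zero _ _ (by simp at hb; omega)]
      simp
  · refine Finset.sum_eq_zero fun i _ => if_neg (by omega)

lemma nullst {N : ℕ} {ι : Type*} (F : ι → MvPolynomial (Fin N) ℂ)
    (hF : ∀ x : Fin N → ℂ, (∀ i, eval x (F i) = 0) → x = 0) :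
    idealOfVars (Fin N) ℂ ≤ (Ideal.span (Set.range F)).radical := by
  rw [← vanishingIdeal_zeroLocus_eq_radical (K := ℂ), Ideal.span_le]
  rintro _ ⟨i, rfl⟩
  rw [SetLike.mem_coe, mem_vanishingIdeal_iff]
  intro x hx
  rw [mem_zeroLocus_iff] at hx
  have : x = 0 := hF x fun i => by
    have := hx (F i) (Ideal.subset_span ⟨i, rfl⟩)
    simpa [aeval_def, eval, eval₂_eq'] using this
  simp [this]

lemma endo_pow {N q : ℕ} {F : Fin N → MvPolynomial (Fin N) ℂ} (h : IsEndo N q F) :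
    ∃ K, idealOfVars (Fin N) ℂ ^ K ≤ Ideal.span (Set.range F) := 
  Ideal.exists_pow_le_of_le_radical_of_fg (nullst F h.2) (idealOfVars_fg _ _)

lemma fin_abs {A R : Type*} [CommRing A] [CommRing R] (φ : A →+* R) (G : Set R) (hG : G.Finite)
    (h : ∀ S : AddSubgroup R, (∀ a x, x ∈ S → φ a * x ∈ S) → G ⊆ S → ∀ x, x ∈ S) : φ.Finite := by
  let _ := φ.toAlgebra
  refine ⟨⟨hG.toFinset, ?_⟩⟩
  rw [Set.Finite.coe_toFinset, eq_top_iff]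
  intro x _
  exact h (Submodule.span A G).toAddSubgroup (fun a x hx => (Submodule.span A G).smul_mem a hx)
    Submodule.subset_span x

lemma endo_finite {N q : ℕ} {F : Fin N → MvPolynomial (Fin N) ℂ} (h : IsEndo N q F) (hq : 1 ≤ q) :
    (aeval F : MvPolynomial (Fin N) ℂ →ₐ[ℂ] MvPolynomial (Fin N) ℂ).toRingHom.Finite := by
  obtain ⟨K, hK⟩ := endo_pow h
  set φ := (aeval F : MvPolynomial (Fin N) ℂ →ₐ[ℂ] MvPolynomial (Fin N) ℂ).toRingHom with hφ
  let G : Set (MvPolynomial (Fin N) ℂ) := (fun m : Fin N →₀ ℕ => (monomial m 1 : MvPolynomial (Fin N) ℂ)) '' {m | m.degree ≤ K + q}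
  have hG : G.Finite := by
    refine Set.Finite.image _ ?_
    exact Finsupp.finite_of_degree_le _
  refine fin_abs φ G hG ?_
  intro S hsm hGS
  have hC : ∀ (c : ℂ) (x : MvPolynomial (Fin N) ℂ), x ∈ S → (C c * x : MvPolynomial (Fin N) ℂ) ∈ S := by
    intro c x hx
    have := hsm (C c) x hx
    rwa [ hφ, AlgHom.toRingHom_eq_coe, RingHom.coe_coe, aeval_C] at this
  have hFm : ∀ (j) (x : MvPolynomial (Fin N) ℂ), x ∈ S → (F j * x : MvPolynomial (Fin N) ℂ) ∈ S := by
    intro c x hx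
    have := hsm (X c) x hx
    rwa [ hφ, AlgHom.toRingHom_eq_coe, RingHom.coe_coe, aeval_X] at this
  have main : ∀ D, ∀ p : MvPolynomial (Fin N) ℂ, p.IsHomogeneous D → p ∈ S := by
    intro D
    induction D using Nat.strong_induction_on with
    | _ D ih =>
      intro p hp
      by_cases hD : D < K + q
      · rw [p.as_sum]
        refine AddSubgroup.sum_mem _ fun m hm => ?_
        have : (monomial m (coeff m p) : MvPolynomial (Fin N) ℂ) = C (coeff m p) * monomial m 1 := by
          rw [C_mul_monomial, mul_one]
        rw [this]
        refine hC _ _ (hGS ⟨m, ?_, rfl⟩)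
        have hd := hp.degree_eq_sum_deg_support hm
        change m.degree ≤ _
        rw [Finsupp.degree_apply]
        omega
      · have hpm : p ∈ Ideal.span (Set.range F) := by
          apply hK
          rw [mem_pow_idealOfVars_iff']
          intro m hm
          exact hp.coeff_eq_zero (by omega)
        rw [Ideal.mem_span_range_iff_exists_fun] at hpm
        obtain ⟨c, hc⟩ := hpm
        have : p = ∑ j, F j * homogeneousComponent (D - q) (c j) := by
          rw [← homogeneousComponent_eq_self hp, ← hc, map_sum]
          refine Finset.sum_congr rfl fun j _ => ?_
          rw [mul_comm, hc_mul (h.1 j), if_pos (by omega)]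
        rw [this]
        refine AddSubgroup.sum_mem _ fun j _ => hFm _ _ ?_
        exact ih (D - q) (by omega) _ (homogeneousComponent_isHomogeneous _ _)
  intro p
  rw [← sum_homogeneousComponent (p : MvPolynomial (Fin N) ℂ)]
  exact AddSubgroup.sum_mem _ fun i _ => main i _ (homogeneousComponent_isHomogeneous _ _)

lemma vars_ker (N : ℕ) : idealOfVars (Fin N) ℂ = RingHom.ker (constantCoeff : MvPolynomial (Fin N) ℂ →+* ℂ) := by
  ext p
  rw [idealOfVars, ← Set.image_univ, mem_ideal_span_X_image, RingHom.mem_ker]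
  constructor
  · intro h
    by_contra hne
    obtain ⟨i, _, hi⟩ := h 0 (by rwa [mem_support_iff])
    simp at hi
  · intro h m hm
    by_contra! hne
    have : m = 0 := by ext i; exact hne i (Set.mem_univ _)
    rw [this, mem_support_iff] at hm
    exact hm h

instance vars_max (N : ℕ) : (idealOfVars (Fin N) ℂ).IsMaximal := by
  rw [vars_ker]
  exact RingHom.ker_isMaximal_of_surjective _ (fun c => ⟨C c, constantCoeff_C _ c⟩)

lemma vars_list (N : ℕ) : idealOfVars (Fin N) ℂ = Ideal.ofList (List.ofFn (X : Fin N → MvPolynomial (Fin N) ℂ)) := by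
  unfold idealOfVars Ideal.ofList
  congr 1
  ext p
  simp [List.mem_ofFn]

lemma rel_raw {N q : ℕ} {F : Fin N → MvPolynomial (Fin N) ℂ} (h : IsEndo N q F) (hq : 1 ≤ q)
    {ι : Type} [Fintype ι] (w p : ι → MvPolynomial (Fin N) ℂ) (hw : ∑ j, aeval F (p j) * w j = 0) :
    ∃ (s : MvPolynomial (Fin N) ℂ) (k : ℕ) (a : ι → Fin k → MvPolynomial (Fin N) ℂ)
      (y : Fin k → MvPolynomial (Fin N) ℂ), constantCoeff s ≠ 0 ∧
      (∀ i, aeval F s * w i = ∑ j, aeval F (a i j) * y j) ∧ ∀ j, ∑ i, p i * a i j = 0 := by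
  have hmap : (idealOfVars (Fin N) ℂ).map
      (aeval F : MvPolynomial (Fin N) ℂ →ₐ[ℂ] MvPolynomial (Fin N) ℂ).toRingHom = Ideal.span (Set.range F) := by
    rw [idealOfVars, Ideal.map_span]
    congr 1
    rw [← Set.range_comp]
    congr 1
    ext1 i
    simp
  obtain ⟨s, k, a, y, hs, h1, h2⟩ := flat_abs
    (aeval F : MvPolynomial (Fin N) ℂ →ₐ[ℂ] MvPolynomial (Fin N) ℂ).toRingHom (endo_finite h hq)
    (idealOfVars (Fin N) ℂ) (idealOfVars (Fin N) ℂ) _ _ rfl (vars_list N) (vars_list N) (X_weakreg N)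
    (by
      rw [hmap, Ideal.span_le]
      rintro _ ⟨i, rfl⟩
      rw [SetLike.mem_coe, vars_ker, RingHom.mem_ker]
      exact (h.1 i).coeff_eq_zero (by simp; omega)) (by
      rw [hmap]; exact nullst F h.2) w p hw
  refine ⟨s, k, a, y, ?_, h1, h2⟩
  rwa [vars_ker, RingHom.mem_ker] at hs

lemma const_aeval {N q : ℕ} {F : Fin N → MvPolynomial (Fin N) ℂ} (h : IsEndo N q F) (hq : 1 ≤ q)
    (s : MvPolynomial (Fin N) ℂ) : constantCoeff (aeval F s) = constantCoeff s := by
  induction s using MvPolynomial.induction_on with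
  | C c => simp
  | add p q hp hq => rw [map_add, map_add, map_add, hp, hq]
  | mul_X p i hp =>
    have : constantCoeff (F i) = 0 := (h.1 i).coeff_eq_zero (by simp; omega)
    rw [map_mul, map_mul, map_mul, hp, aeval_X, this, constantCoeff_X]

lemma aeval_inj {N q : ℕ} {F : Fin N → MvPolynomial (Fin N) ℂ} (h : IsEndo N q F) (hq : 1 ≤ q)
    (p : MvPolynomial (Fin N) ℂ) (hp : aeval F p = 0) : p = 0 := by
  obtain ⟨s, k, a, y, hs, h1, h2⟩ := rel_raw h hq (ι := Unit) (fun _ => 1) (fun _ => p) (by simp only [hp]; simp)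
  by_contra hne
  have ha : ∀ j, a () j = 0 := fun j => by simpa [hne] using h2 j
  have := h1 ()
  simp only [ha, mul_one, map_zero, zero_mul, Finset.sum_const_zero] at this
  have h3 := congrArg constantCoeff this
  rw [const_aeval h hq, map_zero] at h3
  exact hs h3

lemma hc_aeval_mul {N q : ℕ} {F : Fin N → MvPolynomial (Fin N) ℂ} (h : IsEndo N q F) (hq : 1 ≤ q)
    (a y : MvPolynomial (Fin N) ℂ) (D : ℕ) : homogeneousComponent D (aeval F a * y) =
      ∑ e ∈ (Finset.range (D + 1)).filter (fun e => q * e ≤ D),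
        homogeneousComponent (D - q * e) y * aeval F (homogeneousComponent e a) := by
  conv_lhs => rw [← sum_homogeneousComponent a, map_sum, Finset.sum_mul, map_sum]
  have : ∀ e, homogeneousComponent D (aeval F (homogeneousComponent e a) * y) =
      if q * e ≤ D then homogeneousComponent (D - q * e) y * aeval F (homogeneousComponent e a) else 0 := by
    intro e
    rw [hc_mul ((homogeneousComponent_isHomogeneous e a).aeval F h.1), mul_comm (aeval F _)]
  simp_rw [this]
  rw [← Finset.sum_filter]
  have key : ∀ e, (q * e ≤ D ∧ e ∉ (Finset.range (a.totalDegree + 1)) ∨ False) →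
     homogeneousComponent (D - q * e) y * aeval F (homogeneousComponent e a) = 0 := by
    rintro e (⟨h1, h2⟩ | h)
    · rw [homogeneousComponent_eq_zero e a (by simpa using h2)]; simp
    · exact h.elim
  rw [← Finset.sum_filter_of_ne (s := Finset.filter _ (Finset.range (D+1))) (p := fun e => e ∈ Finset.range (a.totalDegree + 1))]
  · refine Finset.sum_congr ?_ fun _ _ => rfl
    ext e
    simp only [Finset.mem_filter, Finset.mem_range]
    constructor
    · rintro ⟨h1, h2⟩
      refine ⟨⟨?_, h2⟩, h1⟩
      nlinarith
    · rintro ⟨⟨h1, h2⟩, h3⟩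
      exact ⟨h3, h2⟩
  · intro e he hne
    by_contra hh
    exact hne (key e (Or.inl ⟨(Finset.mem_filter.mp he).2, hh⟩))

lemma FL {N q : ℕ} {F : Fin N → MvPolynomial (Fin N) ℂ} (h : IsEndo N q F) (hq : 1 ≤ q)
    (r D : ℕ) (w p : Fin N → MvPolynomial (Fin N) ℂ) (hwD : ∀ j, (w j).IsHomogeneous D)
    (hp : ∀ j, (p j).IsHomogeneous r) (hw : ∑ j, w j * aeval F (p j) = 0) :
    ∃ (K : ℕ) (b : Fin K → ℕ → MvPolynomial (Fin N) ℂ) (s : Fin K → ℕ → Fin N → MvPolynomial (Fin N) ℂ),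
      (∀ k e, (b k e).IsHomogeneous (D - q * e)) ∧ (∀ k e j, (s k e j).IsHomogeneous e) ∧
      (∀ k e, ∑ j, s k e j * p j = 0) ∧
      ∀ j, w j = ∑ k, ∑ e ∈ (Finset.range (D + 1)).filter (fun e => q * e ≤ D), b k e * aeval F (s k e j) := by
  obtain ⟨s, K, a, y, hs, h1, h2⟩ := rel_raw h hq w p (by simpa [mul_comm] using hw)
  set c := constantCoeff s with hc
  refine ⟨K, fun k e => C c⁻¹ * homogeneousComponent (D - q * e) (y k),
    fun k e j => homogeneousComponent e (a j k), ?_, ?_, ?_, ?_⟩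
  · intro k e
    exact (homogeneousComponent_isHomogeneous _ _).C_mul _
  · intro k e j
    exact homogeneousComponent_isHomogeneous _ _
  · intro k e
    have := congrArg (homogeneousComponent (r + e)) (h2 k)
    rw [map_sum, map_zero] at this
    rw [← this]
    refine Finset.sum_congr rfl fun j _ => ?_
    rw [hc_mul (hp j), if_pos (by omega), mul_comm]; simp
  · intro j
    have h3 := congrArg (homogeneousComponent D) (h1 j)
    rw [mul_comm, hc_mul (hwD j), if_pos le_rfl, Nat.sub_self, homogeneousComponent_zero, map_sum] at h3
    have h4 : coeff 0 (aeval F s) = c := const_aeval h hq s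
    rw [h4] at h3
    simp_rw [hc_aeval_mul h hq] at h3
    have h5 : w j = C c⁻¹ * (w j * C c) := by
      rw [mul_comm (w j), ← mul_assoc, ← C_mul, inv_mul_cancel₀ hs, C_1, one_mul]
    rw [h5, h3, Finset.mul_sum]
    refine Finset.sum_congr rfl fun k _ => ?_
    rw [Finset.mul_sum]
    refine Finset.sum_congr rfl fun e _ => ?_
    rw [mul_assoc]
end

section
lemma der_zero {A R : Type} [CommRing A] [IsDomain A] [CharZero A] [CommRing R] [IsDomain R]
    (φ : A →+* R) (hφ : ∀ a, φ a = 0 → a = 0) (D : Derivation ℤ R R) (hD : ∀ a, D (φ a) = 0)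
    (x : R) (hx : φ.IsIntegralElem x) : D x = 0 := by
  classical
  have hder : ∀ P : Polynomial A, D (P.eval₂ φ x) = (Polynomial.derivative P).eval₂ φ x * D x := by
    intro P
    induction P using Polynomial.induction_on' with
    | add p q hp hq => simp [Polynomial.eval₂_add, hp, hq, add_mul]
    | monomial n a =>
      rw [Polynomial.eval₂_monomial, Polynomial.derivative_monomial, Polynomial.eval₂_monomial,
        Derivation.leibniz, hD, Derivation.leibniz_pow]
      simp only [smul_eq_mul, nsmul_eq_mul, map_mul, map_natCast, mul_zero, add_zero]
      ring
  obtain ⟨P, hPm, hP⟩ := hx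
  have hex : ∃ n, ∃ P : Polynomial A, P ≠ 0 ∧ P.eval₂ φ x = 0 ∧ P.natDegree = n :=
    ⟨_, P, hPm.ne_zero, hP, rfl⟩
  obtain ⟨Q, hQ0, hQ, hQn⟩ := Nat.find_spec hex
  have hmin := fun m => Nat.find_min hex (m := m)
  have hpos : 0 < Q.natDegree := by
    rw [Nat.pos_iff_ne_zero]
    intro h0
    rw [Polynomial.eq_C_of_natDegree_eq_zero h0, Polynomial.eval₂_C] at hQ
    apply hQ0
    rw [Polynomial.eq_C_of_natDegree_eq_zero h0, hφ _ hQ, Polynomial.C_0]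
  have h1 := hder Q
  rw [hQ, map_zero] at h1
  rcases mul_eq_zero.mp h1.symm with h2 | h2
  · exfalso
    have hlt := Polynomial.natDegree_derivative_lt hpos.ne'
    refine hmin _ (by rw [← hQn]; exact hlt) ⟨_, ?_, h2, rfl⟩
    intro h3
    exact hpos.ne' (Polynomial.derivative_eq_zero.mp h3)
  · exact h2

noncomputable abbrev Dv {N : ℕ} (v : Fin N → MvPolynomial (Fin N) ℂ) :
    Derivation ℂ (MvPolynomial (Fin N) ℂ) (MvPolynomial (Fin N) ℂ) := mkDerivation ℂ v

lemma der_aeval {N : ℕ} (D : Derivation ℂ (MvPolynomial (Fin N) ℂ) (MvPolynomial (Fin N) ℂ))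
    (F : Fin N → MvPolynomial (Fin N) ℂ) (p : MvPolynomial (Fin N) ℂ) :
    D (aeval F p) = ∑ j, D (F j) * aeval F (pderiv j p) := by
  induction p using MvPolynomial.induction_on with
  | C c => rw [aeval_C]; simp
  | add p q hp hq => simp only [map_add, hp, hq, mul_add, Finset.sum_add_distrib]
  | mul_X p i hp =>
    simp only [map_mul, Derivation.leibniz, hp, aeval_X, smul_eq_mul, map_add, pderiv_X, mul_add,
      Finset.sum_add_distrib]
    congr 1
    · rw [Finset.sum_eq_single i]
      · simp; ring
      · intro j _ hj
        rw [Pi.single_eq_of_ne hj.symm]; simp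
      · simp
    · rw [Finset.mul_sum]
      refine Finset.sum_congr rfl fun j _ => ?_
      ring

lemma Dv_apply {N : ℕ} (v : Fin N → MvPolynomial (Fin N) ℂ) (p : MvPolynomial (Fin N) ℂ) :
    Dv v p = ∑ j, v j * pderiv j p := by
  have := der_aeval (Dv v) X p
  simpa using this

lemma Dv_hom {N e d : ℕ} {v : Fin N → MvPolynomial (Fin N) ℂ} (hv : ∀ j, (v j).IsHomogeneous e)
    {p : MvPolynomial (Fin N) ℂ} (hp : p.IsHomogeneous d) : (Dv v p).IsHomogeneous (e + (d - 1)) := by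
  rw [Dv_apply]
  exact IsHomogeneous.sum _ _ _ fun j _ => (hv j).mul hp.pderiv

lemma DF_inj {N q : ℕ} {F : Fin N → MvPolynomial (Fin N) ℂ} (h : IsEndo N q F) (hq : 1 ≤ q)
    (v : Fin N → MvPolynomial (Fin N) ℂ) (hv : ∀ j, Dv v (F j) = 0) : v = 0 := by
  ext1 i
  have h0 : ∀ a, Dv v (aeval F a) = 0 := fun a => by
    rw [der_aeval]
    exact Finset.sum_eq_zero fun j _ => by rw [hv, zero_mul]
  have := der_zero (aeval F : MvPolynomial (Fin N) ℂ →ₐ[ℂ] MvPolynomial (Fin N) ℂ).toRingHom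
    (fun a ha => aeval_inj h hq a ha) ((Dv v).restrictScalars ℤ) h0 (X i)
    ((endo_finite h hq).to_isIntegral (X i))
  have h2 : Dv v (X i) = 0 := this
  simpa using h2

lemma lin_abs {K : Type*} [Field K] {n : ℕ} (σ : K →+* K) (S : Set (Fin n → K))
    (L : (Fin n → K) →ₗ[K] (Fin n → K)) (hL : Function.Injective L)
    (hS : ∀ s ∈ S, L s ∈ Submodule.span K ((fun s => σ ∘ s) '' S)) (v : Fin n → K)
    (hv : L v ∈ Submodule.span K ((fun s => σ ∘ s) '' S)) : v ∈ Submodule.span K S := by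
  obtain ⟨b, hbS, hbs, hli⟩ := exists_linearIndependent K S
  have hbfin : b.Finite := hli.setFinite
  have h1 : Submodule.span K ((fun s => σ ∘ s) '' S) ≤ Submodule.span K ((fun s => σ ∘ s) '' b) := by
    rw [Submodule.span_le]
    rintro _ ⟨s, hs, rfl⟩
    have hs' : s ∈ Submodule.span K b := by rw [hbs]; exact Submodule.subset_span hs
    simp only [SetLike.mem_coe]
    clear hs
    induction hs' using Submodule.span_induction with
    | mem x hx => exact Submodule.subset_span ⟨x, hx, rfl⟩
    | zero => 
      have : (σ ∘ (0 : Fin n → K)) = 0 := by ext; simp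
      rw [this]; exact zero_mem _
    | add x y _ _ hx hy =>
      have : (σ ∘ (x + y)) = σ ∘ x + σ ∘ y := by ext; simp
      rw [this]; exact add_mem hx hy
    | smul a x _ hx =>
      have : (σ ∘ (a • x)) = σ a • (σ ∘ x) := by ext; simp
      rw [this]; exact Submodule.smul_mem _ _ hx
  have h2 : Module.finrank K (Submodule.span K ((fun s => σ ∘ s) '' S)) ≤ Module.finrank K (Submodule.span K S) := by
    refine (Submodule.finrank_mono h1).trans ?_
    have e1 : Module.finrank K (Submodule.span K S) = b.ncard := by
      rw [← hbs, Set.ncard_eq_toFinset_card b hbfin]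
      have := hbfin.fintype
      rw [finrank_span_set_eq_card hli]
      simp
    rw [e1]
    have hf : ((fun s : Fin n → K => σ ∘ s) '' b).Finite := hbfin.image _
    have := hf.fintype
    refine (finrank_span_le_card _).trans ?_
    rw [← Set.ncard_eq_toFinset_card']
    exact Set.ncard_image_le hbfin
  have h3 : (Submodule.span K S).map L ≤ Submodule.span K ((fun s => σ ∘ s) '' S) := by
    rw [Submodule.map_span, Submodule.span_le]
    rintro _ ⟨s, hs, rfl⟩
    exact hS s hs
  have h4 := Submodule.eq_of_le_of_finrank_le h3 (by
    rw [← (Submodule.equivMapOfInjective L hL _).finrank_eq]; exact h2)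
  rw [← h4] at hv
  obtain ⟨u, hu, huv⟩ := hv
  rwa [← hL huv]

def InM {N : ℕ} (h : MvPolynomial (Fin N) ℂ) (e : ℕ) (v : Fin N → MvPolynomial (Fin N) ℂ) : Prop :=
  (∀ j, (v j).IsHomogeneous e) ∧ Dv v h = 0

lemma FLM {N q d e : ℕ} {F : Fin N → MvPolynomial (Fin N) ℂ} (hE : IsEndo N q F) (hq : 2 ≤ q)
    {h : MvPolynomial (Fin N) ℂ} (hh : h.IsHomogeneous d) {lam : ℂ}
    (hinv : aeval F h = C lam * h ^ q) {v : Fin N → MvPolynomial (Fin N) ℂ} (hv : InM h e v) :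
    ∃ (K : ℕ) (b : Fin K → ℕ → MvPolynomial (Fin N) ℂ) (s : Fin K → ℕ → Fin N → MvPolynomial (Fin N) ℂ),
      (∀ k e', (b k e').IsHomogeneous (e + (q - 1) - q * e')) ∧ (∀ k e', InM h e' (s k e')) ∧
      ∀ j, Dv v (F j) = ∑ k, ∑ e' ∈ (Finset.range (e + (q - 1) + 1)).filter (fun e' => q * e' ≤ e + (q - 1)),
        b k e' * aeval F (s k e' j) := by
  obtain ⟨K, b, s, h1, h2, h3, h4⟩ := FL hE (by omega) (d - 1) (e + (q - 1)) (fun j => Dv v (F j))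
    (fun j => pderiv j h) (fun j => Dv_hom hv.1 (hE.1 j)) (fun j => hh.pderiv) (by
      rw [← der_aeval, hinv, Derivation.leibniz, Derivation.leibniz_pow, hv.2, derivation_C]
      simp)
  refine ⟨K, b, s, h1, fun k e' => ⟨h2 k e', ?_⟩, h4⟩
  rw [Dv_apply]; exact h3 k e'

lemma gen_span {N q d : ℕ} {F : Fin N → MvPolynomial (Fin N) ℂ} (hE : IsEndo N q F) (hq : 2 ≤ q)
    {h : MvPolynomial (Fin N) ℂ} (hh : h.IsHomogeneous d) {lam : ℂ}
    (hinv : aeval F h = C lam * h ^ q) (e : ℕ) {v : Fin N → MvPolynomial (Fin N) ℂ} (hv : InM h e v) :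
    (fun j => algebraMap _ (FractionRing (MvPolynomial (Fin N) ℂ)) (v j)) ∈
      Submodule.span (FractionRing (MvPolynomial (Fin N) ℂ))
      ((fun (v : Fin N → MvPolynomial (Fin N) ℂ) j => algebraMap _ (FractionRing (MvPolynomial (Fin N) ℂ)) (v j)) ''
        {v | InM h 0 v ∨ InM h 1 v}) := by
  set K := FractionRing (MvPolynomial (Fin N) ℂ) with hK
  set ι : (Fin N → MvPolynomial (Fin N) ℂ) → (Fin N → K) := fun v j => algebraMap _ K (v j) with hι
  set S0 : Set (Fin N → MvPolynomial (Fin N) ℂ) := {v | InM h 0 v ∨ InM h 1 v} with hS0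
  have hinj : Function.Injective (aeval F : MvPolynomial (Fin N) ℂ →ₐ[ℂ] MvPolynomial (Fin N) ℂ).toRingHom :=
    (injective_iff_map_eq_zero _).mpr fun a ha => aeval_inj hE (by omega) a ha
  let σ : K →+* K := IsFractionRing.map hinj
  have hσ : ∀ p, σ (algebraMap _ K p) = algebraMap _ K (aeval F p) := fun p =>
    IsLocalization.map_eq _ p
  let M : Matrix (Fin N) (Fin N) (MvPolynomial (Fin N) ℂ) := fun j i => pderiv i (F j)
  have hM : ∀ v, M.mulVec v = fun j => Dv v (F j) := by
    intro v
    ext1 j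
    rw [Dv_apply]
    simp only [Matrix.mulVec, dotProduct, M]
    exact Finset.sum_congr rfl fun i _ => mul_comm _ _
  have hdet : M.det ≠ 0 := by
    intro h0
    obtain ⟨v, hv0, hv⟩ := Matrix.exists_mulVec_eq_zero_iff.mpr h0
    apply hv0
    refine DF_inj hE (by omega) v fun j => ?_
    rw [hM] at hv
    exact congrFun hv j
  let MK := (algebraMap (MvPolynomial (Fin N) ℂ) K).mapMatrix M
  have hdetK : MK.det ≠ 0 := by
    rw [← RingHom.map_det]
    simpa using hdet
  have hL : Function.Injective MK.mulVecLin := by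
    rw [injective_iff_map_eq_zero]
    intro u hu
    by_contra hne
    exact hdetK (Matrix.exists_mulVec_eq_zero_iff.mp ⟨u, hne, hu⟩)
  have hLι : ∀ v, MK.mulVecLin (ι v) = ι (fun j => Dv v (F j)) := by
    intro v
    rw [← hM]
    ext1 j
    simp [Matrix.mulVec, dotProduct, MK, ι]
  set W := Submodule.span K ((fun s : Fin N → K => σ ∘ s) '' (ι '' S0)) with hW
  have key : ∀ (e : ℕ) (v : Fin N → MvPolynomial (Fin N) ℂ), InM h e v →
      (∀ e' u, InM h e' u → q * e' ≤ e + (q - 1) → σ ∘ (ι u) ∈ W) → MK.mulVecLin (ι v) ∈ W := by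
    intro e v hv hu
    obtain ⟨k, b, s, h1, h2, h3⟩ := FLM hE hq hh hinv hv
    rw [hLι]
    have : ι (fun j => Dv v (F j)) = ∑ k, ∑ e' ∈ (Finset.range (e + (q - 1) + 1)).filter
        (fun e' => q * e' ≤ e + (q - 1)), algebraMap _ K (b k e') • (σ ∘ (ι (s k e'))) := by
      ext1 j
      simp only [ι, h3, map_sum, map_mul, Finset.sum_apply, Pi.smul_apply, Function.comp_apply, hσ, smul_eq_mul]
    rw [this]
    refine Submodule.sum_mem _ fun k _ => Submodule.sum_mem _ fun e' he' => Submodule.smul_mem _ _ ?_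
    exact hu e' _ (h2 k e') (Finset.mem_filter.mp he').2
  have hW1 : ∀ u ∈ S0, σ ∘ (ι u) ∈ W := fun u hu => Submodule.subset_span ⟨ι u, ⟨u, hu, rfl⟩, rfl⟩
  have hle : ∀ e' e : ℕ, q * e' ≤ e + (q - 1) → e' ≤ 1 ∨ e' < e := by
    intro e' e h1
    by_contra! h2
    obtain ⟨a, rfl⟩ : ∃ a, e' = a + 2 := ⟨e' - 2, by omega⟩
    obtain ⟨r, rfl⟩ : ∃ r, q = r + 2 := ⟨q - 2, by omega⟩
    have : r + 2 - 1 = r + 1 := by omega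
    rw [this] at h1
    nlinarith
  have hS : ∀ s ∈ ι '' S0, MK.mulVecLin s ∈ W := by
    rintro _ ⟨v, hv, rfl⟩
    obtain ⟨e, he, hv'⟩ : ∃ e, e ≤ 1 ∧ InM h e v := by
      rcases hv with hv | hv
      · exact ⟨0, by omega, hv⟩
      · exact ⟨1, by omega, hv⟩
    refine key e v hv' fun e' u hu hle' => hW1 u ?_
    have : e' ≤ 1 := by rcases hle _ _ hle' with h | h <;> omega
    interval_cases e'
    · exact Or.inl hu
    · exact Or.inr hu
  have main := lin_abs σ (ι '' S0) MK.mulVecLin hL hS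
  have hσspan : ∀ x ∈ Submodule.span K (ι '' S0), σ ∘ x ∈ W := by
    intro x hx
    induction hx using Submodule.span_induction with
    | mem x hx => exact Submodule.subset_span ⟨x, hx, rfl⟩
    | zero =>
      have : (σ ∘ (0 : Fin N → K)) = 0 := by ext1; simp
      rw [this]; exact zero_mem _
    | add x y _ _ hx hy =>
      have : (σ ∘ (x + y)) = σ ∘ x + σ ∘ y := by ext1; simp
      rw [this]; exact add_mem hx hy
    | smul a x _ hx =>
      have : (σ ∘ (a • x)) = σ a • (σ ∘ x) := by ext1; simp
      rw [this]; exact Submodule.smul_mem _ _ hx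
  have fin : ∀ e, ∀ v, InM h e v → ι v ∈ Submodule.span K (ι '' S0) := by
    intro e
    induction e using Nat.strong_induction_on with
    | _ e ih =>
      intro v hv
      refine main _ (key e v hv fun e' u hu hle' => ?_)
      rcases hle _ _ hle' with h | h
      · refine hW1 u ?_
        interval_cases e'
        · exact Or.inl hu
        · exact Or.inr hu
      · exact hσspan _ (ih e' h u hu)
  exact fin e v hv

lemma kill {N q d : ℕ} {F : Fin N → MvPolynomial (Fin N) ℂ} (hE : IsEndo N q F) (hq : 2 ≤ q)
    {h : MvPolynomial (Fin N) ℂ} (hh : h.IsHomogeneous d) {lam : ℂ}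
    (hinv : aeval F h = C lam * h ^ q) (p : MvPolynomial (Fin N) ℂ)
    (h0 : ∀ v, InM h 0 v → Dv v p = 0) (h1 : ∀ v, InM h 1 v → Dv v p = 0)
    (e : ℕ) {v : Fin N → MvPolynomial (Fin N) ℂ} (hv : InM h e v) : Dv v p = 0 := by
  have hs := gen_span hE hq hh hinv e hv
  have key : ∀ x ∈ Submodule.span (FractionRing (MvPolynomial (Fin N) ℂ))
      ((fun (v : Fin N → MvPolynomial (Fin N) ℂ) j => algebraMap _ (FractionRing (MvPolynomial (Fin N) ℂ)) (v j)) ''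
        {v | InM h 0 v ∨ InM h 1 v}), ∑ j, x j * algebraMap _ (FractionRing (MvPolynomial (Fin N) ℂ)) (pderiv j p) = 0 := by
    intro x hx
    induction hx using Submodule.span_induction with
    | mem x hx =>
      obtain ⟨v, hv, rfl⟩ := hx
      have : Dv v p = 0 := by
        rcases hv with hv | hv
        · exact h0 v hv
        · exact h1 v hv
      rw [Dv_apply] at this
      simp only [← map_mul, ← map_sum, this, map_zero]
    | zero => simp
    | add x y _ _ hx hy => simp only [Pi.add_apply, add_mul, Finset.sum_add_distrib, hx, hy, add_zero]
    | smul a x _ hx => simp only [Pi.smul_apply, smul_eq_mul, mul_assoc, ← Finset.mul_sum, hx, mul_zero]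
  have := key _ hs
  simp only [← map_mul, ← map_sum] at this
  rw [Dv_apply]
  exact (IsFractionRing.injective _ (FractionRing (MvPolynomial (Fin N) ℂ))) (by rw [this, map_zero])
end

section
noncomputable def act {N : ℕ} (B : Matrix (Fin N) (Fin N) ℂ) (G : Fin N → MvPolynomial (Fin N) ℂ) :
    Fin N → MvPolynomial (Fin N) ℂ := fun j => ∑ i, C (B j i) * G i

section act
variable {N : ℕ} (A B : Matrix (Fin N) (Fin N) ℂ) (G H : Fin N → MvPolynomial (Fin N) ℂ)

lemma act_mul : act (A * B) G = act A (act B G) := by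
  ext1 j
  simp only [act, Matrix.mul_apply, map_sum, map_mul, Finset.sum_mul, Finset.mul_sum]
  rw [Finset.sum_comm]
  exact Finset.sum_congr rfl fun i _ => Finset.sum_congr rfl fun k _ => by ring

lemma act_add : act (A + B) G = act A G + act B G := by
  ext1 j
  simp only [act, Matrix.add_apply, map_add, add_mul, Finset.sum_add_distrib, Pi.add_apply]

lemma act_sub : act (A - B) G = act A G - act B G := by
  ext1 j
  simp only [act, Matrix.sub_apply, map_sub, sub_mul, Finset.sum_sub_distrib, Pi.sub_apply]

lemma act_smul (c : ℂ) : act (c • A) G = fun j => C c * act A G j := by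
  ext1 j
  simp only [act, Matrix.smul_apply, smul_eq_mul, map_mul, mul_assoc, Finset.mul_sum]

lemma act_one : act (1 : Matrix (Fin N) (Fin N) ℂ) G = G := by
  ext1 j
  simp [act, Matrix.one_apply]

lemma act_zero : act (0 : Matrix (Fin N) (Fin N) ℂ) G = 0 := by
  ext1 j
  simp [act]

lemma act_add' : act A (G + H) = act A G + act A H := by
  ext1 j
  simp only [act, Pi.add_apply, mul_add, Finset.sum_add_distrib]

lemma act_sub' : act A (G - H) = act A G - act A H := by
  ext1 j
  simp only [act, Pi.sub_apply, mul_sub, Finset.sum_sub_distrib]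

lemma act_der (D : Derivation ℂ (MvPolynomial (Fin N) ℂ) (MvPolynomial (Fin N) ℂ)) :
    (fun j => D (act A G j)) = act A (fun j => D (G j)) := by
  ext1 j
  simp only [act, map_sum, Derivation.leibniz, derivation_C, smul_eq_mul, mul_zero, add_zero]

lemma act_const (c : Fin N → ℂ) : act A (fun j => C (c j)) = fun j => C (A.mulVec c j) := by
  ext1 j
  simp only [act, Matrix.mulVec, dotProduct, map_sum, map_mul]

lemma eval_act (x : Fin N → ℂ) : (fun j => eval x (act A G j)) = A.mulVec (fun j => eval x (G j)) := by
  ext1 j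
  simp only [act, Matrix.mulVec, dotProduct, map_sum, map_mul, eval_C]

lemma aeval_act (F : Fin N → MvPolynomial (Fin N) ℂ) (j) :
    aeval F (act A G j) = act A (fun j => aeval F (G j)) j := by
  simp only [act, map_sum, map_mul, aeval_C, algebraMap_eq]

lemma act_hom {e : ℕ} (hG : ∀ j, (G j).IsHomogeneous e) (j) : (act A G j).IsHomogeneous e :=
  IsHomogeneous.sum _ _ _ fun i _ => (hG i).C_mul _

end act

noncomputable def lf {N : ℕ} (A : Matrix (Fin N) (Fin N) ℂ) : Fin N → MvPolynomial (Fin N) ℂ := act A X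

lemma lf_inj {N : ℕ} {A : Matrix (Fin N) (Fin N) ℂ} (h : lf A = 0) : A = 0 := by
  ext j i
  have := congrArg (fun p => eval (Pi.single i 1) p) (congrFun h j)
  simpa [lf, act, Pi.single_apply] using this

lemma lf_hom {N : ℕ} (A : Matrix (Fin N) (Fin N) ℂ) (j) : (lf A j).IsHomogeneous 1 :=
  act_hom A X (fun i => isHomogeneous_X _ i) j

lemma hom1 {N : ℕ} {v : Fin N → MvPolynomial (Fin N) ℂ} (hv : ∀ j, (v j).IsHomogeneous 1) :
    ∃ A, v = lf A := by
  have : ∀ j, ∃ a : Fin N → ℂ, v j = ∑ i, C (a i) * X i := by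
    intro j
    have h1 : v j ∈ homogeneousSubmodule (Fin N) ℂ 1 := hv j
    rw [homogeneousSubmodule_one_eq_span_X, Submodule.mem_span_range_iff_exists_fun] at h1
    obtain ⟨c, hc⟩ := h1
    exact ⟨c, by rw [← hc]; exact Finset.sum_congr rfl fun i _ => by rw [smul_eq_C_mul]⟩
  choose a ha using this
  exact ⟨Matrix.of a, by ext1 j; rw [ha]; rfl⟩

lemma hom0 {N : ℕ} {p : MvPolynomial (Fin N) ℂ} (hp : p.IsHomogeneous 0) : ∃ c, p = C c := by
  refine ⟨coeff 0 p, ?_⟩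
  rw [← homogeneousComponent_zero, homogeneousComponent_eq_self hp]

lemma F_indep {N q : ℕ} {F : Fin N → MvPolynomial (Fin N) ℂ} (h : IsEndo N q F) (hq : 1 ≤ q)
    {A : Matrix (Fin N) (Fin N) ℂ} (hA : act A F = 0) : A = 0 := by
  apply lf_inj
  ext1 j
  refine aeval_inj h hq _ ?_
  rw [lf, aeval_act]
  simpa using congrFun hA j

lemma Dv_lf_comm {N : ℕ} (A B : Matrix (Fin N) (Fin N) ℂ) (p : MvPolynomial (Fin N) ℂ) :
    Dv (lf A) (Dv (lf B) p) - Dv (lf B) (Dv (lf A) p) = Dv (lf (B * A - A * B)) p := by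
  have : ⁅Dv (lf A), Dv (lf B)⁆ = Dv (lf (B * A - A * B)) := by
    refine derivation_ext fun i => ?_
    have h1 := congrFun (act_der B X (Dv (lf A))) i
    have h2 := congrFun (act_der A X (Dv (lf B))) i
    simp only [mkDerivation_X] at h1 h2
    simp only [Derivation.commutator_apply, mkDerivation_X]
    unfold lf at *
    rw [h1, h2, act_sub, act_mul, act_mul]
    rfl
  rw [← this, Derivation.commutator_apply]

lemma Dv_const_comm {N : ℕ} (c : Fin N → ℂ) (B : Matrix (Fin N) (Fin N) ℂ) (p : MvPolynomial (Fin N) ℂ) :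
    Dv (fun j => C (c j)) (Dv (lf B) p) - Dv (lf B) (Dv (fun j => C (c j)) p) =
      Dv (fun j => C (B.mulVec c j)) p := by
  have : ⁅Dv (fun j => C (c j)), Dv (lf B)⁆ = Dv (fun j => C (B.mulVec c j)) := by
    refine derivation_ext fun i => ?_
    have h1 := congrFun (act_der B X (Dv (fun j => C (c j)))) i
    simp only [mkDerivation_X] at h1
    simp only [Derivation.commutator_apply, mkDerivation_X, derivation_C, sub_zero]
    unfold lf at *
    rw [h1, act_const]
  rw [← this, Derivation.commutator_apply]

structure Ctx {N : ℕ} (q d : ℕ) (F : Fin N → MvPolynomial (Fin N) ℂ) (h : MvPolynomial (Fin N) ℂ)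
    (T : Matrix (Fin N) (Fin N) ℂ) : Prop where
  hE : IsEndo N q F
  hq : 2 ≤ q
  hh : h.IsHomogeneous d
  hinv : ∃ lam : ℂ, aeval F h = C lam * h ^ q
  hT : T * T = T
  hker : ∀ c : Fin N → ℂ, T.mulVec c = 0 ↔ Dv (fun j => C (c j)) h = 0

namespace Ctx
variable {N q d : ℕ} {F : Fin N → MvPolynomial (Fin N) ℂ} {h : MvPolynomial (Fin N) ℂ}
    {T : Matrix (Fin N) (Fin N) ℂ} (X0 : Ctx q d F h T)
include X0

lemma DT (G : Fin N → MvPolynomial (Fin N) ℂ) (p : MvPolynomial (Fin N) ℂ)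
    (hp : ∀ c : Fin N → ℂ, T.mulVec c = 0 → Dv (fun j => C (c j)) p = 0) : Dv G p = Dv (act T G) p := by
  have h1 : ∀ i : Fin N, Dv (fun j => C ((1 - T).mulVec (Pi.single i 1) j)) p = 0 := by
    intro i
    apply hp
    rw [Matrix.mulVec_mulVec, mul_sub, X0.hT, mul_one, sub_self, Matrix.zero_mulVec]
  have h2 : Dv (act (1 - T) G) p = 0 := by
    rw [Dv_apply]
    simp only [act, Finset.sum_mul]
    rw [Finset.sum_comm]
    refine Finset.sum_eq_zero fun i _ => ?_
    have := h1 i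
    rw [Dv_apply] at this
    rw [← mul_zero (G i), ← this, Finset.mul_sum]
    refine Finset.sum_congr rfl fun j _ => ?_
    simp; ring
  rw [act_sub, act_one, Dv_apply] at h2
  rw [Dv_apply, Dv_apply, ← sub_eq_zero, ← Finset.sum_sub_distrib, ← h2]
  refine Finset.sum_congr rfl fun j _ => ?_
  rw [Pi.sub_apply, sub_mul]

lemma DTh (G : Fin N → MvPolynomial (Fin N) ℂ) : Dv G h = Dv (act T G) h :=
  X0.DT G h fun c hc => (X0.hker c).mp hc

lemma TB {B : Matrix (Fin N) (Fin N) ℂ} (hB : InM h 1 (lf B)) : T * B * T = T * B := by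
  have : T * B * (1 - T) = 0 := by
    refine Matrix.mulVec_injective (funext fun x => ?_)
    show (T * B * (1 - T)).mulVec x = (0 : Matrix (Fin N) (Fin N) ℂ).mulVec x
    rw [Matrix.zero_mulVec, mul_assoc, ← Matrix.mulVec_mulVec, X0.hker]
    have h1 := Dv_const_comm ((1 - T).mulVec x) B h
    have h2 : Dv (fun j => C ((1 - T).mulVec x j)) h = 0 := by
      rw [← X0.hker, Matrix.mulVec_mulVec, mul_sub, X0.hT, mul_one, sub_self, Matrix.zero_mulVec]
    rw [hB.2, h2, map_zero, map_zero, sub_zero] at h1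
    rw [← Matrix.mulVec_mulVec]
    exact h1.symm
  rw [mul_sub, mul_one, sub_eq_zero] at this
  exact this.symm

lemma const0 {c : Fin N → ℂ} (hc : T.mulVec c = 0) : act T (fun j => Dv (fun j => C (c j)) (F j)) = 0 := by
  obtain ⟨lam, hinv⟩ := X0.hinv
  have hv : InM h 0 (fun j => C (c j)) := ⟨fun j => isHomogeneous_C _ _, (X0.hker c).mp hc⟩
  obtain ⟨K, b, s, h1, h2, h3⟩ := FLM X0.hE X0.hq X0.hh hinv hv
  have hfil : (Finset.range (0 + (q - 1) + 1)).filter (fun e' => q * e' ≤ 0 + (q - 1)) = {0} := by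
    ext e
    simp only [Finset.mem_filter, Finset.mem_range, Finset.mem_singleton]
    have := X0.hq
    constructor
    · rintro ⟨h1, h2⟩
      by_contra hne
      have : q * 1 ≤ q * e := Nat.mul_le_mul_left _ (by omega)
      omega
    · rintro rfl; simp
  have hs : ∀ k, ∃ c : Fin N → ℂ, (s k 0 = fun j => C (c j)) ∧ T.mulVec c = 0 := by
    intro k
    have := fun j => hom0 ((h2 k 0).1 j)
    choose c hc using this
    have e : s k 0 = fun j => C (c j) := funext hc
    refine ⟨c, e, ?_⟩
    rw [X0.hker, ← e]; exact (h2 k 0).2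
  choose c' hc1 hc2 using hs
  have h4 : (fun j => Dv (fun j => C (c j)) (F j)) = fun j => ∑ k, b k 0 * C (c' k j) := by
    ext1 j
    rw [h3 j]
    refine Finset.sum_congr rfl fun k _ => ?_
    rw [hfil, Finset.sum_singleton, hc1, aeval_C]; rfl
  rw [h4]
  ext1 j
  have h5 : ∀ k, ∑ i, C (T j i) * (C (c' k i) : MvPolynomial (Fin N) ℂ) = 0 := by
    intro k
    have := congrFun (act_const T (c' k)) j
    rw [hc2] at this
    simpa [act] using this
  simp only [act, Finset.mul_sum, Pi.zero_apply]
  rw [Finset.sum_comm]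
  refine Finset.sum_eq_zero fun k _ => ?_
  rw [← mul_zero (b k 0), ← h5 k, Finset.mul_sum]
  exact Finset.sum_congr rfl fun i _ => by ring

end Ctx
end

section
lemma DF_K {N q : ℕ} {F : Fin N → MvPolynomial (Fin N) ℂ} (hE : IsEndo N q F) (hq : 2 ≤ q) :
    ∃ L : (Fin N → FractionRing (MvPolynomial (Fin N) ℂ)) →ₗ[FractionRing (MvPolynomial (Fin N) ℂ)]
      (Fin N → FractionRing (MvPolynomial (Fin N) ℂ)), Function.Injective L ∧
      ∀ v : Fin N → MvPolynomial (Fin N) ℂ,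
        L (fun j => algebraMap _ (FractionRing (MvPolynomial (Fin N) ℂ)) (v j)) =
          fun j => algebraMap _ (FractionRing (MvPolynomial (Fin N) ℂ)) (Dv v (F j)) := by
  set K := FractionRing (MvPolynomial (Fin N) ℂ) with hK
  let M : Matrix (Fin N) (Fin N) (MvPolynomial (Fin N) ℂ) := fun j i => pderiv i (F j)
  have hM : ∀ v, M.mulVec v = fun j => Dv v (F j) := by
    intro v
    ext1 j
    rw [Dv_apply]
    simp only [Matrix.mulVec, dotProduct, M]
    exact Finset.sum_congr rfl fun i _ => mul_comm _ _
  have hdet : M.det ≠ 0 := by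
    intro h0
    obtain ⟨v, hv0, hv⟩ := Matrix.exists_mulVec_eq_zero_iff.mpr h0
    apply hv0
    refine DF_inj hE (by omega) v fun j => ?_
    rw [hM] at hv
    exact congrFun hv j
  let MK := (algebraMap (MvPolynomial (Fin N) ℂ) K).mapMatrix M
  have hdetK : MK.det ≠ 0 := by
    rw [← RingHom.map_det]
    simpa using hdet
  refine ⟨MK.mulVecLin, ?_, ?_⟩
  · rw [injective_iff_map_eq_zero]
    intro u hu
    by_contra hne
    exact hdetK (Matrix.exists_mulVec_eq_zero_iff.mp ⟨u, hne, hu⟩)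
  · intro v
    have := hM v
    ext1 j
    rw [← congrFun this j]
    simp [Matrix.mulVec, dotProduct, MK]
    rfl

attribute [local instance] LieRing.ofAssociativeRing

def gg {N : ℕ} (h : MvPolynomial (Fin N) ℂ) (T : Matrix (Fin N) (Fin N) ℂ) :
    LieSubalgebra ℂ (Matrix (Fin N) (Fin N) ℂ) where
  carrier := {A | Dv (lf A) h = 0 ∧ A * T = A ∧ T * A = A}
  add_mem' := by
    rintro A B ⟨h1, h2, h3⟩ ⟨k1, k2, k3⟩
    refine ⟨?_, by rw [add_mul, h2, k2], by rw [mul_add, h3, k3]⟩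
    rw [Dv_apply] at *
    simp only [lf, act_add, Pi.add_apply, add_mul, Finset.sum_add_distrib]
    unfold lf at h1 k1
    rw [h1, k1, add_zero]
  zero_mem' := by
    refine ⟨?_, by simp, by simp⟩
    rw [Dv_apply]
    simp [lf, act_zero]
  smul_mem' := by
    rintro c A ⟨h1, h2, h3⟩
    refine ⟨?_, by rw [smul_mul_assoc, h2], by rw [mul_smul_comm, h3]⟩
    rw [Dv_apply] at *
    unfold lf at *
    simp only [act_smul, mul_assoc, ← Finset.mul_sum, h1, mul_zero]
  lie_mem' := by
    rintro A B ⟨h1, h2, h3⟩ ⟨k1, k2, k3⟩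
    refine ⟨?_, ?_, ?_⟩
    · rw [Ring.lie_def, ← Dv_lf_comm, h1, k1]; simp
    · rw [Ring.lie_def, sub_mul, mul_assoc, mul_assoc, h2, k2]
    · rw [Ring.lie_def, mul_sub, ← mul_assoc, ← mul_assoc, h3, k3]

lemma mem_gg {N : ℕ} {h : MvPolynomial (Fin N) ℂ} {T A : Matrix (Fin N) (Fin N) ℂ} :
    A ∈ gg h T ↔ Dv (lf A) h = 0 ∧ A * T = A ∧ T * A = A := Iff.rfl

namespace Ctx
variable {N q d : ℕ} {F : Fin N → MvPolynomial (Fin N) ℂ} {h : MvPolynomial (Fin N) ℂ}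
    {T : Matrix (Fin N) (Fin N) ℂ} (X0 : Ctx q d F h T)
include X0

lemma TBT {B : Matrix (Fin N) (Fin N) ℂ} (hB : Dv (lf B) h = 0) : T * B ∈ gg h T := by
  have hM : InM h 1 (lf B) := ⟨lf_hom B, hB⟩
  refine ⟨?_, X0.TB hM, by rw [← mul_assoc, X0.hT]⟩
  have := X0.DTh (lf B)
  rw [hB] at this
  rw [lf, act_mul]; exact this.symm

lemma FL1 {A : Matrix (Fin N) (Fin N) ℂ} (hA : Dv (lf A) h = 0) :
    ∃ B, B ∈ gg h T ∧ act T (fun j => Dv (lf A) (F j)) = act B F := by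
  obtain ⟨lam, hinv⟩ := X0.hinv
  have hv : InM h 1 (lf A) := ⟨lf_hom A, hA⟩
  obtain ⟨K, b, s, h1, h2, h3⟩ := FLM X0.hE X0.hq X0.hh hinv hv
  have hq := X0.hq
  have hfil : (Finset.range (1 + (q - 1) + 1)).filter (fun e' => q * e' ≤ 1 + (q - 1)) = {0, 1} := by
    ext e
    simp only [Finset.mem_filter, Finset.mem_range, Finset.mem_singleton, Finset.mem_insert]
    constructor
    · rintro ⟨h1, h2⟩
      by_contra hne
      have : q * 2 ≤ q * e := Nat.mul_le_mul_left _ (by omega)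
      omega
    · rintro (rfl | rfl)
      · simp
      · omega
  have hs : ∀ k, ∃ c : Fin N → ℂ, (s k 0 = fun j => C (c j)) ∧ T.mulVec c = 0 := by
    intro k
    have := fun j => hom0 ((h2 k 0).1 j)
    choose c hc using this
    have e : s k 0 = fun j => C (c j) := funext hc
    refine ⟨c, e, ?_⟩
    rw [X0.hker, ← e]; exact (h2 k 0).2
  choose c' hc1 hc2 using hs
  choose B hB using fun k => hom1 (h2 k 1).1
  have hb : ∀ k, ∃ β, b k 1 = C β := fun k => hom0 (by
    have := h1 k 1
    rwa [show 1 + (q - 1) - q * 1 = 0 by omega] at this)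
  choose β hβ using hb
  have hBm : ∀ k, T * B k ∈ gg h T := fun k => X0.TBT (by rw [← hB]; exact (h2 k 1).2)
  refine ⟨∑ k, β k • (T * B k), sum_mem fun k _ => (gg h T).smul_mem _ (hBm k), ?_⟩
  have h4 : (fun j => Dv (lf A) (F j)) = fun j => ∑ k, (b k 0 * C (c' k j) + C (β k) * act (B k) F j) := by
    ext1 j
    rw [h3 j]
    refine Finset.sum_congr rfl fun k _ => ?_
    rw [hfil, Finset.sum_pair (by simp), hc1, aeval_C, hβ, hB, lf, aeval_act]
    simp
  rw [h4]
  ext1 j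
  have h5 : ∀ k, ∑ i, C (T j i) * (C (c' k i) : MvPolynomial (Fin N) ℂ) = 0 := by
    intro k
    have := congrFun (act_const T (c' k)) j
    rw [hc2] at this
    simpa [act] using this
  have h6 : act (∑ k, β k • (T * B k)) F j = ∑ k, C (β k) * act T (act (B k) F) j := by
    have : ∀ k, act T (act (B k) F) = act (T * B k) F := fun k => (act_mul _ _ _).symm
    simp only [this]
    simp only [act, Matrix.sum_apply, map_sum, Finset.sum_mul, Finset.mul_sum, Matrix.smul_apply, smul_eq_mul, map_mul]
    rw [Finset.sum_comm]
    refine Finset.sum_congr rfl fun k _ => Finset.sum_congr rfl fun i _ => by ring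
  rw [h6]
  conv_lhs => simp only [act, Finset.mul_sum]
  rw [Finset.sum_comm]
  refine Finset.sum_congr rfl fun k _ => ?_
  have h7 : ∑ i, C (T j i) * (b k 0 * C (c' k i)) = 0 := by
    rw [← mul_zero (b k 0), ← h5 k, Finset.mul_sum]
    exact Finset.sum_congr rfl fun i _ => by ring
  simp only [mul_add, Finset.sum_add_distrib]
  rw [h7, zero_add]
  conv_rhs => simp only [act]
  rw [Finset.mul_sum]
  refine Finset.sum_congr rfl fun i _ => ?_
  rw [mul_left_comm, ← Finset.mul_sum]

lemma inj_aux {A : Matrix (Fin N) (Fin N) ℂ} (hA : act T (fun j => Dv (lf A) (F j)) = 0) : T * A = 0 := by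
  obtain ⟨L, hL, hLι⟩ := DF_K X0.hE X0.hq
  set K := FractionRing (MvPolynomial (Fin N) ℂ) with hK
  let ι : (Fin N → MvPolynomial (Fin N) ℂ) → (Fin N → K) := fun v j => algebraMap _ K (v j)
  let S : Set (Fin N → K) := ι '' {v | ∃ c : Fin N → ℂ, T.mulVec c = 0 ∧ v = fun j => C (c j)}
  have hG : ∀ G : Fin N → MvPolynomial (Fin N) ℂ, act T G = 0 → ι G ∈ Submodule.span K S := by
    intro G hG
    have h1 : G = act (1 - T) G := by rw [act_sub, hG, act_one, sub_zero]
    have h2 : ι G = ∑ i, algebraMap _ K (G i) • ι (fun j => C ((1 - T).mulVec (Pi.single i 1) j)) := by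
      conv_lhs => rw [h1]
      ext1 j
      simp only [ι, act, map_sum, map_mul, Finset.sum_apply, Pi.smul_apply, smul_eq_mul, Matrix.mulVec_single_one, Matrix.col_apply]
      exact Finset.sum_congr rfl fun i _ => mul_comm _ _
    rw [h2]
    refine Submodule.sum_mem _ fun i _ => Submodule.smul_mem _ _ (Submodule.subset_span ⟨_, ⟨_, ?_, rfl⟩, rfl⟩)
    rw [Matrix.mulVec_mulVec, mul_sub, X0.hT, mul_one, sub_self, Matrix.zero_mulVec]
  have hid : ((fun s => (RingHom.id K) ∘ s) '' S) = S := by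
    ext s; simp
  have := lin_abs (RingHom.id K) S L hL (by
    rw [hid]
    rintro _ ⟨_, ⟨c, hc, rfl⟩, rfl⟩
    rw [hLι]
    exact hG _ (X0.const0 hc)) (ι (lf A)) (by
    rw [hid, hLι]
    exact hG _ hA)
  have key : ∀ x ∈ Submodule.span K S, ∀ j, ∑ i, algebraMap (MvPolynomial (Fin N) ℂ) K (C (T j i)) * x i = 0 := by
    intro x hx j
    induction hx using Submodule.span_induction with
    | mem x hx =>
      obtain ⟨_, ⟨c, hc, rfl⟩, rfl⟩ := hx
      simp only [ι, ← map_mul, ← map_sum]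
      have := congrFun hc j
      simp only [Matrix.mulVec, dotProduct, Pi.zero_apply] at this
      rw [this]; simp
    | zero => simp
    | add x y _ _ hx hy => simp only [Pi.add_apply, mul_add, Finset.sum_add_distrib, hx, hy, add_zero]
    | smul a x _ hx => simp only [Pi.smul_apply, smul_eq_mul, mul_left_comm, ← Finset.mul_sum, hx, mul_zero]
  apply lf_inj
  ext1 j
  have := key _ this j
  simp only [ι, ← map_mul, ← map_sum] at this
  have h3 := IsFractionRing.injective _ K (this.trans (map_zero _).symm)
  rw [lf, act_mul]
  exact h3

lemma exists_phi : ∃ φ : gg h T →ₗ[ℂ] gg h T, Function.Injective φ ∧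
    ∀ A : gg h T, act T (fun j => Dv (lf (A : Matrix (Fin N) (Fin N) ℂ)) (F j)) = act (φ A : Matrix (Fin N) (Fin N) ℂ) F := by
  have hq := X0.hq
  have h1 : ∀ A : gg h T, ∃ B : gg h T, act T (fun j => Dv (lf (A : Matrix (Fin N) (Fin N) ℂ)) (F j)) =
      act (B : Matrix (Fin N) (Fin N) ℂ) F := fun A => by
    obtain ⟨B, hB, h⟩ := X0.FL1 A.2.1
    exact ⟨⟨B, hB⟩, h⟩
  choose f hf using h1
  have huniq : ∀ B C : Matrix (Fin N) (Fin N) ℂ, act B F = act C F → B = C := fun B C hBC =>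
    sub_eq_zero.mp (F_indep X0.hE (by omega) (by rw [act_sub, hBC, sub_self]))
  let φ : gg h T →ₗ[ℂ] gg h T :=
    { toFun := f
      map_add' := fun A B => by
        refine Subtype.ext (huniq _ _ ?_)
        rw [← hf]
        show _ = act ((f A : Matrix (Fin N) (Fin N) ℂ) + (f B : Matrix (Fin N) (Fin N) ℂ)) F
        rw [act_add, ← hf, ← hf, ← act_add']
        congr 1; ext1 j
        simp only [Pi.add_apply, Dv_apply, ← Finset.sum_add_distrib, ← add_mul]
        refine Finset.sum_congr rfl fun i _ => ?_
        show lf ((A : Matrix (Fin N) (Fin N) ℂ) + (B : Matrix (Fin N) (Fin N) ℂ)) i * _ = _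
        rw [lf, act_add]; rfl
      map_smul' := fun c A => by
        refine Subtype.ext (huniq _ _ ?_)
        rw [← hf]
        show _ = act (c • (f A : Matrix (Fin N) (Fin N) ℂ)) F
        rw [act_smul, ← hf]
        ext1 j
        simp only [act, Dv_apply, Finset.mul_sum]
        refine Finset.sum_congr rfl fun i _ => Finset.sum_congr rfl fun k _ => ?_
        show _ * (lf (c • (A : Matrix (Fin N) (Fin N) ℂ)) k * _) = _
        rw [lf, act_smul]; unfold lf; ring }
  refine ⟨φ, ?_, hf⟩
  rw [injective_iff_map_eq_zero]
  intro A hA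
  have h2 := hf A
  have h3 : f A = 0 := hA
  rw [h3] at h2
  have h4 := X0.inj_aux (A := A) (by rw [h2]; exact act_zero F)
  rw [A.2.2.2] at h4
  exact Subtype.ext h4

end Ctx
end

section
lemma poly_der {n : ℕ} (f : Fin n → Polynomial ℂ) (p : MvPolynomial (Fin n) ℂ) :
    Polynomial.derivative (aeval f p) = ∑ j, Polynomial.derivative (f j) * aeval f (pderiv j p) := by
  induction p using MvPolynomial.induction_on with
  | C c => rw [aeval_C]; simp
  | add p q hp hq => simp only [map_add, hp, hq, mul_add, Finset.sum_add_distrib]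
  | mul_X p i hp =>
    simp only [map_mul, Derivation.leibniz, Polynomial.derivative_mul, hp, aeval_X, smul_eq_mul, map_add, pderiv_X, mul_add,
      Finset.sum_add_distrib]
    rw [add_comm]
    congr 1
    · rw [Finset.sum_eq_single i]
      · simp; ring
      · intro j _ hj
        rw [Pi.single_eq_of_ne hj.symm]; simp
      · simp
    · rw [Finset.sum_mul]
      refine Finset.sum_congr rfl fun j _ => ?_
      ring

lemma trans_inv {n : ℕ} {c : Fin n → ℂ} {p : MvPolynomial (Fin n) ℂ}
    (hp : Dv (fun j => C (c j)) p = 0) (x : Fin n → ℂ) : eval (x + c) p = eval x p := by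
  let f : Fin n → Polynomial ℂ := fun i => Polynomial.C (x i) + Polynomial.X * Polynomial.C (c i)
  have h1 : Polynomial.derivative (aeval f p) = 0 := by
    rw [poly_der]
    rw [Dv_apply] at hp
    have := congrArg (aeval f) hp
    simp only [map_sum, map_mul, aeval_C, map_zero] at this
    rw [← this]
    refine Finset.sum_congr rfl fun j _ => ?_
    simp [f]
  have h2 : ∀ t : ℂ, Polynomial.eval t (aeval f p) = eval (x + t • c) p := by
    intro t
    have : ((Polynomial.aeval t).comp (aeval f) : MvPolynomial (Fin n) ℂ →ₐ[ℂ] ℂ) = aeval (x + t • c) := by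
      refine algHom_ext fun i => ?_
      simp only [AlgHom.comp_apply, aeval_X, f, map_add, map_mul, Polynomial.aeval_C, Polynomial.aeval_X]
      rfl
    have := DFunLike.congr_fun this p
    rw [← aeval_eq_eval, ← this]
    rfl
  have h3 := Polynomial.derivative_eq_zero.mp h1
  have h4 := Polynomial.eq_C_of_natDegree_eq_zero h3
  have e1 := h2 1
  have e0 := h2 0
  rw [h4] at e1 e0
  simp only [Polynomial.eval_C, one_smul, zero_smul, add_zero] at e1 e0
  rw [← e1, ← e0]

lemma eval_smul' {n e : ℕ} {p : MvPolynomial (Fin n) ℂ} (hp : p.IsHomogeneous e) (t : ℂ) (x : Fin n → ℂ) :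
    eval (t • x) p = t ^ e * eval x p := by
  rw [eval_eq, eval_eq, Finset.mul_sum]
  refine Finset.sum_congr rfl fun m hm => ?_
  have h1 := hp (mem_support_iff.mp hm)
  simp only [Pi.smul_apply, smul_eq_mul, mul_pow, Finset.prod_mul_distrib]
  have : ∏ i ∈ m.support, t ^ m i = t ^ e := by
    rw [Finset.prod_pow_eq_pow_sum, ← h1, Finsupp.weight_apply, Finsupp.sum]
    simp
  rw [this]; ring

namespace Ctx
variable {N q d : ℕ} {F : Fin N → MvPolynomial (Fin N) ℂ} {h : MvPolynomial (Fin N) ℂ}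
    {T : Matrix (Fin N) (Fin N) ℂ} (X0 : Ctx q d F h T)
include X0

lemma TF_trans {c : Fin N → ℂ} (hc : T.mulVec c = 0) (x : Fin N → ℂ) :
    T.mulVec (fun j => eval (x + c) (F j)) = T.mulVec (fun j => eval x (F j)) := by
  rw [← eval_act, ← eval_act]
  ext1 j
  refine trans_inv ?_ x
  have := congrFun (act_der T F (Dv fun j => C (c j))) j
  refine this.trans ?_
  rw [X0.const0 hc]; rfl

lemma TF_ne {v : Fin N → ℂ} (hv : T.mulVec v = v) (hv0 : v ≠ 0) :
    T.mulVec (fun j => eval v (F j)) ≠ 0 := by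
  intro hTF
  have hq := X0.hq
  let C0 : Submodule ℂ (Fin N → ℂ) := LinearMap.ker T.mulVecLin
  have hC0 : ∀ x, x ∈ C0 ↔ T.mulVec x = 0 := fun x => by simp [C0]
  let k := Module.finrank ℂ C0
  let b := Module.finBasis ℂ C0
  obtain ⟨Q, hQ⟩ := LinearMap.exists_extend b.equivFun.toLinearMap
  have hQ' : ∀ x, T.mulVec x = 0 → Q x = 0 → x = 0 := by
    intro x hx hQx
    have := LinearMap.congr_fun hQ ⟨x, (hC0 x).mpr hx⟩
    simp only [LinearMap.comp_apply, Submodule.subtype_apply, hQx] at this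
    have h2 : b.equivFun ⟨x, (hC0 x).mpr hx⟩ = 0 := this.symm
    rw [LinearEquiv.map_eq_zero_iff] at h2
    exact congrArg Subtype.val h2
  let W : Fin N → MvPolynomial (Fin (k + 1)) ℂ := fun j => X 0 * C (v j) + ∑ i : Fin k, X i.succ * C ((b i : Fin N → ℂ) j)
  have hW : ∀ j, (W j).IsHomogeneous 1 := by
    intro j
    refine IsHomogeneous.add ?_ (IsHomogeneous.sum _ _ _ fun i _ => ?_)
    · exact (isHomogeneous_X ℂ _).mul (isHomogeneous_C _ _)
    · exact (isHomogeneous_X ℂ _).mul (isHomogeneous_C _ _)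
  let G : Fin k → MvPolynomial (Fin (k + 1)) ℂ := fun i => ∑ j, C (Q (Pi.single j 1) i) * aeval W (F j)
  let F' : Fin (k + 1) → MvPolynomial (Fin (k + 1)) ℂ := Fin.cons 0 G
  have hF' : IsEndo (k + 1) q F' := by
    refine ⟨fun i => ?_, fun y hy => ?_⟩
    · refine Fin.cases ?_ (fun i => ?_) i
      · exact isHomogeneous_zero _ _ _
      · refine IsHomogeneous.sum _ _ _ fun j _ => IsHomogeneous.C_mul ?_ _
        have := (X0.hE.1 j).aeval W hW
        rwa [one_mul] at this
    · set c : Fin N → ℂ := ∑ i : Fin k, y i.succ • (b i : Fin N → ℂ) with hc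
      have hcC : T.mulVec c = 0 := (hC0 c).mp (Submodule.sum_mem _ fun i _ => Submodule.smul_mem _ _ (b i).2)
      have hw : (fun j => eval y (W j)) = y 0 • v + c := by
        ext1 j
        simp [W, c]
      have hev : ∀ p : MvPolynomial (Fin N) ℂ, eval y (aeval W p) = eval (y 0 • v + c) p := by
        intro p
        rw [← hw]
        have : ((aeval y).comp (aeval W) : MvPolynomial (Fin N) ℂ →ₐ[ℂ] ℂ) = aeval (fun j => eval y (W j)) := by
          refine algHom_ext fun i => ?_
          simp
        have := DFunLike.congr_fun this p
        rw [← aeval_eq_eval, ← aeval_eq_eval]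
        exact this
      set u : Fin N → ℂ := fun j => eval (y 0 • v + c) (F j) with hu
      have hTu : T.mulVec u = 0 := by
        rw [hu, X0.TF_trans hcC]
        have : (fun j => eval (y 0 • v) (F j)) = (y 0) ^ q • fun j => eval v (F j) := by
          ext1 j
          rw [eval_smul' (X0.hE.1 j)]; rfl
        rw [this, Matrix.mulVec_smul, hTF, smul_zero]
      have hQu : Q u = 0 := by
        ext i
        have h1 := hy i.succ
        simp only [F', Fin.cons_succ, G, map_sum, map_mul, eval_C, hev] at h1
        rw [LinearMap.pi_apply_eq_sum_univ Q u, Finset.sum_apply, Pi.zero_apply]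
        refine Eq.trans ?_ h1
        refine Finset.sum_congr rfl fun j _ => ?_
        have : (fun j_1 => if j = j_1 then (1:ℂ) else 0) = Pi.single j 1 := by
          ext1 l
          simp [Pi.single_apply, eq_comm]
        rw [this, Pi.smul_apply, smul_eq_mul, mul_comm]
      have hu0 := hQ' u hTu hQu
      have hw0 := X0.hE.2 (y 0 • v + c) fun i => congrFun hu0 i
      have hy0 : y 0 = 0 := by
        have := congrArg T.mulVec hw0
        rw [Matrix.mulVec_add, Matrix.mulVec_smul, hv, hcC, add_zero, Matrix.mulVec_zero] at this
        exact (smul_eq_zero.mp this).resolve_right hv0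
      rw [hy0, zero_smul, zero_add] at hw0
      have hc0 : ∑ i : Fin k, y i.succ • b i = 0 := by
        apply Subtype.ext
        refine Eq.trans ?_ hw0
        simp [c]
      have := Fintype.linearIndependent_iff.mp b.linearIndependent _ hc0
      ext i
      refine Fin.cases hy0 (fun i => this i) i
  have := aeval_inj hF' (by omega) (X 0) (by simp [F'])
  exact X_ne_zero _ this

lemma eig {A B : Matrix (Fin N) (Fin N) ℂ} (hA : A ∈ gg h T) (hB : B ∈ gg h T)
    (hAB : act T (fun j => Dv (lf A) (F j)) = act B F) {μ : ℂ} (hμ : μ ≠ 0)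
    {v : Fin N → ℂ} (hv0 : v ≠ 0) (hv : A.mulVec v = μ • v) :
    ∃ u : Fin N → ℂ, u ≠ 0 ∧ B.mulVec u = (q * μ) • u := by
  have hTv : T.mulVec v = v := by
    have h1 : T.mulVec (A.mulVec v) = A.mulVec v := by rw [Matrix.mulVec_mulVec, hA.2.2]
    rw [hv, Matrix.mulVec_smul] at h1
    exact smul_right_injective _ hμ h1
  refine ⟨T.mulVec (fun j => eval v (F j)), X0.TF_ne hTv hv0, ?_⟩
  have h2 : (fun j => eval v (act T (fun j => Dv (lf A) (F j)) j)) = fun j => eval v (act B F j) := by rw [hAB]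
  rw [eval_act, eval_act] at h2
  rw [Matrix.mulVec_mulVec, hB.2.1, ← h2]
  have h3 : (fun j => eval v (Dv (lf A) (F j))) = (q * μ) • fun j => eval v (F j) := by
    ext1 j
    have e := congrArg (eval v) (X0.hE.1 j).sum_X_mul_pderiv
    simp only [map_sum, map_mul, eval_X, nsmul_eq_mul, map_natCast] at e
    have h4 : ∀ i, eval v (lf A i) = μ * v i := by
      intro i
      have := congrFun (eval_act A X v) i
      simp only [eval_X] at this
      rw [lf, this]
      show A.mulVec v i = _
      rw [hv]; rfl
    rw [Dv_apply]
    simp only [map_sum, map_mul, h4, Pi.smul_apply, smul_eq_mul]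
    rw [mul_comm (q : ℂ), mul_assoc, ← e, Finset.mul_sum]
    exact Finset.sum_congr rfl fun i _ => by ring
  rw [h3, Matrix.mulVec_smul]

end Ctx
end

section
attribute [local instance] LieRing.ofAssociativeRing

lemma gen_eig {V : Type*} [AddCommGroup V] [Module ℂ V] (f : Module.End ℂ V) (μ : ℂ) (k : ℕ) (v : V)
    (hv : v ≠ 0) (hk : ((f - algebraMap ℂ _ μ) ^ k) v = 0) : ∃ u, u ≠ 0 ∧ f u = μ • u := by
  induction k generalizing v with
  | zero => simp at hk; exact absurd hk hv
  | succ k ih =>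
    by_cases h0 : (f - algebraMap ℂ _ μ) v = 0
    · refine ⟨v, hv, ?_⟩
      rwa [LinearMap.sub_apply, Module.algebraMap_end_apply, sub_eq_zero] at h0
    · refine ih _ h0 ?_
      rw [pow_succ] at hk
      exact hk

lemma nilp_of_eig {V : Type*} [AddCommGroup V] [Module ℂ V] [FiniteDimensional ℂ V] (f : Module.End ℂ V)
    (hf : ∀ μ : ℂ, ∀ u, u ≠ 0 → f u = μ • u → μ = 0) : IsNilpotent f := by
  have h1 := Module.End.iSup_maxGenEigenspace_eq_top f
  have h2 : ∀ μ, f.maxGenEigenspace μ ≤ f.maxGenEigenspace 0 := by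
    intro μ
    by_cases hμ : μ = 0
    · rw [hμ]
    · intro v hv
      rw [Module.End.mem_maxGenEigenspace] at hv
      obtain ⟨k, hk⟩ := hv
      by_cases hv0 : v = 0
      · rw [hv0]; exact zero_mem _
      · obtain ⟨u, hu, hu2⟩ := gen_eig f μ k v hv0 hk
        exact absurd (hf μ u hu hu2) hμ
  have h3 : f.maxGenEigenspace 0 = ⊤ := top_le_iff.mp (h1 ▸ iSup_le h2)
  rw [Module.End.maxGenEigenspace_eq_genEigenspace_finrank] at h3
  refine ⟨Module.finrank ℂ V, ?_⟩
  ext v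
  have : v ∈ f.genEigenspace 0 (Module.finrank ℂ V) := by rw [h3]; trivial
  rw [Module.End.mem_genEigenspace_nat] at this
  simpa using this

lemma pair_eig {N : ℕ} {A B : Matrix (Fin N) (Fin N) ℂ} {α : ℂ} (hAB : A * B - B * A = α • B) (hB : B ≠ 0) :
    ∃ (ν : ℂ) (v : Fin N → ℂ), v ≠ 0 ∧ A.mulVec v = ν • v ∧ ‖α‖ / 2 ≤ ‖ν‖ := by
  let a : Module.End ℂ (Fin N → ℂ) := A.mulVecLin
  let b : Module.End ℂ (Fin N → ℂ) := B.mulVecLin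
  have hab : ∀ v, a (b v) = b (a v) + α • b v := by
    intro v
    have := congrArg (fun M => M.mulVec v) hAB
    simp only [Matrix.sub_mulVec, Matrix.smul_mulVec, ← Matrix.mulVec_mulVec] at this
    show A.mulVec (B.mulVec v) = B.mulVec (A.mulVec v) + α • B.mulVec v
    rw [← this]; abel
  obtain ⟨μ, w, hw, hbw⟩ : ∃ μ, ∃ w ∈ a.maxGenEigenspace μ, b w ≠ 0 := by
    by_contra! hcon
    apply hB
    have h1 : (⨆ μ, a.maxGenEigenspace μ) ≤ LinearMap.ker b := iSup_le fun μ w hw => hcon μ w hw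
    rw [Module.End.iSup_maxGenEigenspace_eq_top] at h1
    refine Matrix.mulVec_injective (funext fun x => ?_)
    have : b x = 0 := h1 trivial
    simpa [b] using this
  rw [Module.End.mem_maxGenEigenspace] at hw
  obtain ⟨k, hk⟩ := hw
  have hk' : ((a - algebraMap ℂ _ μ) ^ k) w = 0 := hk
  have hcomm : ∀ (k : ℕ) w, ((a - algebraMap ℂ _ (μ + α)) ^ k) (b w) = b (((a - algebraMap ℂ _ μ) ^ k) w) := by
    intro k
    induction k with
    | zero => intro w; simp
    | succ k ih =>
      intro w
      rw [pow_succ, pow_succ, Module.End.mul_apply, Module.End.mul_apply, ← ih]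
      congr 1
      simp only [LinearMap.sub_apply, Module.algebraMap_end_apply, hab, map_sub, map_smul, add_smul]
      abel
  have hw0 : w ≠ 0 := by rintro rfl; simp at hbw
  obtain ⟨u1, hu1, e1⟩ := gen_eig a μ k w hw0 hk'
  obtain ⟨u2, hu2, e2⟩ := gen_eig a (μ + α) k (b w) hbw (by rw [hcomm, hk', map_zero])
  by_cases hle : ‖α‖ / 2 ≤ ‖μ‖
  · exact ⟨μ, u1, hu1, e1, hle⟩
  · refine ⟨μ + α, u2, hu2, e2, ?_⟩
    have := norm_sub_norm_le α (-μ)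
    rw [norm_neg, sub_neg_eq_add, add_comm α] at this
    linarith

namespace Ctx
variable {N q d : ℕ} {F : Fin N → MvPolynomial (Fin N) ℂ} {h : MvPolynomial (Fin N) ℂ}
    {T : Matrix (Fin N) (Fin N) ℂ} (X0 : Ctx q d F h T)
include X0

lemma phi_lie {A B A' B' E : Matrix (Fin N) (Fin N) ℂ}
    (hA' : A' ∈ gg h T) (hB' : B' ∈ gg h T)
    (h1 : act T (fun j => Dv (lf A) (F j)) = act A' F) (h2 : act T (fun j => Dv (lf B) (F j)) = act B' F)
    (h3 : act T (fun j => Dv (lf (A * B - B * A)) (F j)) = act E F) : E = A' * B' - B' * A' := by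
  have hq := X0.hq
  have key : ∀ A B A' B' : Matrix (Fin N) (Fin N) ℂ, A' ∈ gg h T →
      act T (fun j => Dv (lf A) (F j)) = act A' F → act T (fun j => Dv (lf B) (F j)) = act B' F →
      act T (fun j => Dv (lf B) (Dv (lf A) (F j))) = act (A' * B') F := by
    intro A B A' B' hA' h1 h2
    rw [← act_der T (fun j => Dv (lf A) (F j)), h1, act_der, act_mul, ← h2, ← act_mul, hA'.2.1]
  have e : act E F = act (A' * B' - B' * A') F := by
    rw [← h3, act_sub, ← key A B A' B' hA' h1 h2, ← key B A B' A' hB' h2 h1, ← act_sub']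
    congr 1
    ext1 j
    rw [← Dv_lf_comm]; rfl
  exact sub_eq_zero.mp (F_indep X0.hE (by omega) (by rw [act_sub, e, sub_self]))

lemma ad_zero {α : ℂ} {A B : Matrix (Fin N) (Fin N) ℂ} (hA : A ∈ gg h T) (hB : B ∈ gg h T)
    (hB0 : B ≠ 0) (hAB : A * B - B * A = α • B) : α = 0 := by
  by_contra hα
  have hq := X0.hq
  obtain ⟨φ, hφ, hφF⟩ := X0.exists_phi
  have hsurj : Function.Surjective φ := LinearMap.injective_iff_surjective.mp hφ
  have hpos : 0 < ‖α‖ := norm_pos_iff.mpr hα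
  have key : ∀ k : ℕ, ∀ A B : gg h T, B ≠ 0 →
      (A : Matrix (Fin N) (Fin N) ℂ) * (B : Matrix (Fin N) (Fin N) ℂ) - (B : Matrix (Fin N) (Fin N) ℂ) * (A : Matrix (Fin N) (Fin N) ℂ) = α • (B : Matrix (Fin N) (Fin N) ℂ) →
      ∃ (ν : ℂ) (v : Fin N → ℂ), v ≠ 0 ∧ (A : Matrix (Fin N) (Fin N) ℂ).mulVec v = ν • v ∧ (q : ℝ) ^ k * (‖α‖ / 2) ≤ ‖ν‖ := by
    intro k
    induction k with
    | zero =>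
      intro A B hB0 hAB
      obtain ⟨ν, v, h1, h2, h3⟩ := pair_eig hAB (fun h => hB0 (Subtype.ext h))
      exact ⟨ν, v, h1, h2, by simpa using h3⟩
    | succ k ih =>
      intro A B hB0 hAB
      obtain ⟨A', rfl⟩ := hsurj A
      obtain ⟨B', rfl⟩ := hsurj B
      have hB0' : B' ≠ 0 := by rintro rfl; simp at hB0
      have hbr := X0.phi_lie (E := (φ ⁅A', B'⁆ : gg h T)) (φ A').2 (φ B').2 (hφF A') (hφF B') (hφF ⁅A', B'⁆)
      rw [hAB] at hbr
      have h2 : φ ⁅A', B'⁆ = φ (α • B') := by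
        rw [map_smul]; exact Subtype.ext hbr
      have h3 := congrArg Subtype.val (hφ h2)
      obtain ⟨ν, v, hv, hAv, hν⟩ := ih A' B' hB0' h3
      have hqk : (0:ℝ) < (q : ℝ) ^ k := by positivity
      have hν0 : ν ≠ 0 := by
        rintro rfl
        rw [norm_zero] at hν
        have : 0 < (q : ℝ) ^ k * (‖α‖ / 2) := by positivity
        linarith
      obtain ⟨u, hu, hu2⟩ := X0.eig A'.2 (φ A').2 (hφF A') hν0 hv hAv
      refine ⟨_, u, hu, hu2, ?_⟩
      rw [norm_mul, Complex.norm_natCast, pow_succ, mul_comm _ (q : ℝ), mul_assoc]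
      exact mul_le_mul_of_nonneg_left hν (by positivity)
  have hfin := (Module.End.finite_hasEigenvalue (A.mulVecLin : Module.End ℂ (Fin N → ℂ)))
  obtain ⟨R, hR⟩ := (hfin.image (fun z => ‖z‖)).bddAbove
  have hq1 : (1:ℝ) < q := by exact_mod_cast (by omega : 1 < q)
  obtain ⟨k, hk⟩ := pow_unbounded_of_one_lt (R / (‖α‖ / 2)) hq1
  obtain ⟨ν, v, hv, hAv, hν⟩ := key k ⟨A, hA⟩ ⟨B, hB⟩ (fun h => hB0 (congrArg Subtype.val h)) hAB
  have h1 : ‖ν‖ ≤ R := hR ⟨ν, Module.End.hasEigenvalue_of_hasEigenvector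
    (Module.End.hasEigenvector_iff.mpr ⟨Module.End.mem_eigenspace_iff.mpr hAv, hv⟩), rfl⟩
  rw [div_lt_iff₀ (by positivity)] at hk
  linarith

lemma nilp : LieRing.IsNilpotent (gg h T) := by
  rw [LieAlgebra.isNilpotent_iff_forall (R := ℂ)]
  intro A
  refine nilp_of_eig _ fun μ B hB hAB => ?_
  refine X0.ad_zero A.2 B.2 (fun h => hB (Subtype.ext h)) (α := μ) ?_
  exact congrArg Subtype.val hAB

end Ctx
end

section
lemma gen_mul {R : Type*} [CommRing R] [Algebra ℂ R] (D : Derivation ℂ R R) (a b : ℂ) (x y : R)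
    (hx : x ∈ Module.End.maxGenEigenspace (D : Module.End ℂ R) a)
    (hy : y ∈ Module.End.maxGenEigenspace (D : Module.End ℂ R) b) :
    x * y ∈ Module.End.maxGenEigenspace (D : Module.End ℂ R) (a + b) := by
  rw [Module.End.mem_maxGenEigenspace] at *
  obtain ⟨k, hk⟩ := hx
  obtain ⟨l, hl⟩ := hy
  have step : ∀ x y : R, ((D : Module.End ℂ R) - (a + b) • (1 : Module.End ℂ R)) (x * y) =
      ((D : Module.End ℂ R) - a • (1 : Module.End ℂ R)) x * y + x * ((D : Module.End ℂ R) - b • (1 : Module.End ℂ R)) y := by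
    intro x y
    simp only [LinearMap.sub_apply, LinearMap.smul_apply, Module.End.one_apply, Derivation.coeFn_coe,
      Derivation.leibniz, smul_eq_mul, add_smul, LinearMap.add_apply, sub_mul, mul_sub, smul_mul_assoc, mul_smul_comm]
    ring
  have key : ∀ n : ℕ, ∀ k l : ℕ, k + l = n → ∀ x y : R, (((D : Module.End ℂ R) - a • (1 : Module.End ℂ R)) ^ k) x = 0 →
      (((D : Module.End ℂ R) - b • (1 : Module.End ℂ R)) ^ l) y = 0 →
      (((D : Module.End ℂ R) - (a + b) • (1 : Module.End ℂ R)) ^ n) (x * y) = 0 := by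
    intro n
    induction n with
    | zero =>
      intro k l hkl x y hx hy
      obtain ⟨rfl, rfl⟩ : k = 0 ∧ l = 0 := by omega
      simp only [pow_zero, Module.End.one_apply] at *
      rw [hx, zero_mul]
    | succ n ih =>
      intro k l hkl x y hx hy
      rcases k with _ | k
      · simp only [pow_zero, Module.End.one_apply] at hx
        rw [hx, zero_mul, map_zero]
      rcases l with _ | l
      · simp only [pow_zero, Module.End.one_apply] at hy
        rw [hy, mul_zero, map_zero]
      rw [pow_succ, Module.End.mul_apply, step, map_add]
      rw [ih k (l + 1) (by omega) _ y (by rw [pow_succ] at hx; exact hx) hy,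
        ih (k + 1) l (by omega) x _ hx (by rw [pow_succ] at hy; exact hy), add_zero]
  exact ⟨k + l, key _ k l rfl x y hk hl⟩

lemma der_prod {R : Type*} [CommRing R] [Algebra ℂ R] (D : Derivation ℂ R R) {d : ℕ} (f : Fin d → R) (c : Fin d → ℂ)
    (hf : ∀ i, D (f i) = c i • f i) (s : Finset (Fin d)) : D (∏ i ∈ s, f i) = (∑ i ∈ s, c i) • ∏ i ∈ s, f i := by
  classical
  induction s using Finset.induction_on with
  | empty => simp
  | insert a s ha ih =>
    rw [Finset.prod_insert ha, Finset.sum_insert ha, Derivation.leibniz, ih, hf]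
    simp only [smul_eq_mul, add_smul, mul_smul_comm]
    rw [add_comm, mul_comm (f a)]

lemma weights {L M R : Type*} [LieRing L] [LieAlgebra ℂ L] [LieRing.IsNilpotent L] [AddCommGroup M] [Module ℂ M]
    [FiniteDimensional ℂ M] [LieRingModule L M] [LieModule ℂ L M] [CommRing R] [IsDomain R] [Algebra ℂ R]
    (D : L → Derivation ℂ R R) (ℓ : M →ₗ[ℂ] R) (hD : ∀ A m, D A (ℓ m) = ℓ ⁅A, m⁆) (d : ℕ) (h : R)
    (hh : h ∈ (LinearMap.range ℓ) ^ d) (h0 : h ≠ 0) (hDh : ∀ A, D A h = 0) :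
    ∃ m : Fin d → M, (∀ i, m i ≠ 0) ∧ ∀ A, D A (∏ i, ℓ (m i)) = 0 := by
  have hex : ∃ c : Fin d → LieModule.Weight ℂ L M, ∀ A, ∑ i, c i A = 0 := by
    by_contra! hcon
    let f : (Fin d → LieModule.Weight ℂ L M) → Module.Dual ℂ L := fun c => ∑ i, LieModule.Weight.toLinear ℂ L M (c i)
    obtain ⟨A, hA⟩ := Module.Dual.exists_forall_ne_zero_of_forall_exists f (by
      intro c
      obtain ⟨A, hA⟩ := hcon c
      exact ⟨A, by simpa [f] using hA⟩)
    have hA' : ∀ c : Fin d → LieModule.Weight ℂ L M, ∑ i, c i A ≠ 0 := fun c => by simpa [f] using hA c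
    let G : ℂ → Submodule ℂ R := fun μ => Module.End.maxGenEigenspace (D A : Module.End ℂ R) μ
    let E : LieModule.Weight ℂ L M → Submodule ℂ R := fun χ => (LieModule.genWeightSpace M χ).toSubmodule.map ℓ
    have hE : ∀ χ, E χ ≤ G (χ A) := by
      rintro χ _ ⟨m, hm, rfl⟩
      have hm' := (LieModule.mem_genWeightSpace M _ m).mp hm A
      obtain ⟨k, hk⟩ := hm'
      refine (Module.End.mem_maxGenEigenspace _ _ _).mpr ⟨k, ?_⟩
      have : ∀ k m, (((D A : Module.End ℂ R) - χ A • (1 : Module.End ℂ R)) ^ k) (ℓ m) =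
          ℓ (((LieModule.toEnd ℂ L M A - χ A • (1 : Module.End ℂ M)) ^ k) m) := by
        intro k
        induction k with
        | zero => intro m; simp
        | succ k ih =>
          intro m
          rw [pow_succ, pow_succ, Module.End.mul_apply, Module.End.mul_apply, ← ih]
          congr 1
          simp [hD]
      rw [this, hk, map_zero]
    have hrange : LinearMap.range ℓ = ⨆ χ, E χ := by
      have := LieModule.iSup_genWeightSpace_eq_top' ℂ L M
      rw [← LieSubmodule.toSubmodule_inj, LieSubmodule.iSup_toSubmodule, LieSubmodule.top_toSubmodule] at this
      rw [← Submodule.map_top, ← this, Submodule.map_iSup]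
    have hpow : ∀ d : ℕ, (⨆ χ, E χ) ^ d ≤ ⨆ c : Fin d → LieModule.Weight ℂ L M, G (∑ i, c i A) := by
      intro d
      induction d with
      | zero =>
        refine le_trans ?_ (le_iSup _ (fun i => i.elim0))
        rw [pow_zero, Submodule.one_le]
        simp only [Finset.univ_eq_empty, Finset.sum_empty]
        exact (Module.End.mem_maxGenEigenspace _ _ _).mpr ⟨1, by simp⟩
      | succ d ih =>
        rw [pow_succ]
        refine (show _ ≤ (⨆ c : Fin d → LieModule.Weight ℂ L M, G (∑ i, c i A)) * (⨆ χ, E χ) from mul_le_mul_left ih _).trans ?_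
        rw [Submodule.iSup_mul]
        refine iSup_le fun c => ?_
        rw [Submodule.mul_iSup]
        refine iSup_le fun χ => ?_
        refine le_trans ?_ (le_iSup _ (Fin.snoc c χ))
        rw [Submodule.mul_le]
        intro x hx y hy
        rw [Fin.sum_univ_castSucc]
        simp only [Fin.snoc_castSucc, Fin.snoc_last]
        exact gen_mul _ _ _ x y hx (hE χ hy)
    rw [hrange] at hh
    have h1 := hpow d hh
    have h2 : h ∈ ⨆ μ, ⨆ (_ : μ ≠ 0), G μ := by
      refine (iSup_le fun c => ?_ : _ ≤ ⨆ μ, ⨆ (_ : μ ≠ 0), G μ) h1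
      exact le_iSup₂_of_le _ (hA' c) le_rfl
    have h3 : h ∈ G 0 := (Module.End.mem_maxGenEigenspace _ _ _).mpr ⟨1, by simp [hDh]⟩
    have h4 := (Module.End.independent_maxGenEigenspace (D A : Module.End ℂ R)) 0
    exact h0 (Submodule.disjoint_def.mp h4 h h3 h2)
  obtain ⟨c, hc⟩ := hex
  choose m hm0 hm using fun i => LieModule.exists_forall_lie_eq_smul ℂ L M (c i)
  refine ⟨m, hm0, fun A => ?_⟩
  rw [der_prod (D A) (fun i => ℓ (m i)) (fun i => c i A) (fun i => by rw [hD, hm, map_smul]), hc, zero_smul]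
end

section
attribute [local instance] LieRing.ofAssociativeRing

def LTm {N : ℕ} (T : Matrix (Fin N) (Fin N) ℂ) : Submodule ℂ (Fin N → ℂ) where
  carrier := {a | Matrix.vecMul a T = a}
  add_mem' := by
    intro a b ha hb
    simp only [Set.mem_ofPred_eq] at *
    rw [Matrix.add_vecMul, ha, hb]
  zero_mem' := by simp
  smul_mem' := by
    intro c a ha
    simp only [Set.mem_ofPred_eq] at *
    rw [Matrix.smul_vecMul, ha]

instance {N : ℕ} (h : MvPolynomial (Fin N) ℂ) (T : Matrix (Fin N) (Fin N) ℂ) :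
    LieRingModule (gg h T) (LTm T) where
  bracket A a := ⟨-(Matrix.vecMul a.1 A.1), by
    show Matrix.vecMul _ T = _
    rw [Matrix.neg_vecMul, Matrix.vecMul_vecMul, A.2.2.1]⟩
  add_lie A B a := by
    apply Subtype.ext
    show -(Matrix.vecMul a.1 (A.1 + B.1)) = -(Matrix.vecMul a.1 A.1) + -(Matrix.vecMul a.1 B.1)
    rw [Matrix.vecMul_add, neg_add]
  lie_add A a b := by
    apply Subtype.ext
    show -(Matrix.vecMul (a.1 + b.1) A.1) = -(Matrix.vecMul a.1 A.1) + -(Matrix.vecMul b.1 A.1)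
    rw [Matrix.add_vecMul, neg_add]
  leibniz_lie A B a := by
    apply Subtype.ext
    show -(Matrix.vecMul (-(Matrix.vecMul a.1 B.1)) A.1) =
      -(Matrix.vecMul a.1 (A.1 * B.1 - B.1 * A.1)) + -(Matrix.vecMul (-(Matrix.vecMul a.1 A.1)) B.1)
    simp only [Matrix.neg_vecMul, Matrix.vecMul_vecMul, Matrix.vecMul_sub, neg_neg]
    abel

instance {N : ℕ} (h : MvPolynomial (Fin N) ℂ) (T : Matrix (Fin N) (Fin N) ℂ) :
    LieModule ℂ (gg h T) (LTm T) where
  smul_lie c A a := by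
    apply Subtype.ext
    show -(Matrix.vecMul a.1 (c • A.1)) = c • -(Matrix.vecMul a.1 A.1)
    rw [Matrix.vecMul_smul, smul_neg]
  lie_smul c A a := by
    apply Subtype.ext
    show -(Matrix.vecMul (c • a.1) A.1) = c • -(Matrix.vecMul a.1 A.1)
    rw [Matrix.smul_vecMul, smul_neg]

noncomputable def ell {N : ℕ} : (Fin N → ℂ) →ₗ[ℂ] MvPolynomial (Fin N) ℂ where
  toFun a := ∑ i, C (a i) * X i
  map_add' a b := by simp [add_mul, Finset.sum_add_distrib]
  map_smul' c a := by simp [smul_eq_C_mul, Finset.mul_sum, mul_assoc]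

lemma ell_apply {N : ℕ} (a : Fin N → ℂ) : ell a = ∑ i, C (a i) * X i := rfl

lemma ell_hom {N : ℕ} (a : Fin N → ℂ) : (ell a).IsHomogeneous 1 :=
  IsHomogeneous.sum _ _ _ fun i _ => (isHomogeneous_X ℂ i).C_mul _

lemma ell_ne {N : ℕ} {a : Fin N → ℂ} (ha : a ≠ 0) : ell a ≠ 0 := by
  intro h
  apply ha
  ext i
  have := congrArg (fun p => eval (Pi.single i 1) p) h
  simpa [ell_apply, Pi.single_apply] using this

lemma Dv_ell {N : ℕ} (v : Fin N → MvPolynomial (Fin N) ℂ) (a : Fin N → ℂ) :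
    Dv v (ell a) = ∑ i, C (a i) * v i := by
  simp [ell_apply, map_sum, Derivation.leibniz, derivation_C, mkDerivation_X]

lemma Dv_lf_ell {N : ℕ} (A : Matrix (Fin N) (Fin N) ℂ) (a : Fin N → ℂ) :
    Dv (lf A) (ell a) = ell (Matrix.vecMul a A) := by
  rw [Dv_ell, ell_apply]
  simp only [lf, act, Matrix.vecMul, dotProduct, map_sum, map_mul, Finset.sum_mul, Finset.mul_sum]
  rw [Finset.sum_comm]
  exact Finset.sum_congr rfl fun i _ => Finset.sum_congr rfl fun k _ => by ring

lemma Dv_c_ell {N : ℕ} (c : Fin N → ℂ) (a : Fin N → ℂ) :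
    Dv (fun j => C (c j)) (ell a) = C (a ⬝ᵥ c) := by
  rw [Dv_ell]
  simp only [dotProduct, map_sum, map_mul]

lemma exists_T {N : ℕ} (h : MvPolynomial (Fin N) ℂ) : ∃ T : Matrix (Fin N) (Fin N) ℂ, T * T = T ∧
    ∀ c : Fin N → ℂ, T.mulVec c = 0 ↔ Dv (fun j => C (c j)) h = 0 := by
  let W : Submodule ℂ (Fin N → ℂ) :=
    { carrier := {c | Dv (fun j => C (c j)) h = 0}
      add_mem' := by
        intro a b ha hb
        simp only [Set.mem_ofPred_eq, Dv_apply] at *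
        simp [add_mul, Finset.sum_add_distrib, ha, hb]
      zero_mem' := by
        simp only [Set.mem_ofPred_eq, Dv_apply]
        simp
      smul_mem' := by
        intro c a ha
        simp only [Set.mem_ofPred_eq, Dv_apply] at *
        simp [mul_assoc, ← Finset.mul_sum, ha] }
  obtain ⟨V, hV⟩ := Submodule.exists_isCompl W
  let P := V.subtype ∘ₗ (Submodule.projectionOnto V W hV.symm)
  have hP : ∀ c, P c = 0 ↔ c ∈ W := by
    intro c
    show ((V.projectionOnto W hV.symm c : V) : Fin N → ℂ) = 0 ↔ _
    rw [ZeroMemClass.coe_eq_zero]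
    exact Submodule.projectionOnto_apply_eq_zero_iff hV.symm
  have hPP : P * P = P := by
    refine LinearMap.ext fun c => ?_
    show ((V.projectionOnto W hV.symm ((V.projectionOnto W hV.symm c : V) : Fin N → ℂ) : V) : Fin N → ℂ) = _
    rw [Submodule.projectionOnto_apply_left]
    rfl
  refine ⟨LinearMap.toMatrix' P, ?_, ?_⟩
  · rw [← LinearMap.toMatrix'_mul, hPP]
  · intro c
    rw [LinearMap.toMatrix'_mulVec, hP]
    rfl

namespace Ctx
variable {N q d : ℕ} {F : Fin N → MvPolynomial (Fin N) ℂ} {h : MvPolynomial (Fin N) ℂ}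
    {T : Matrix (Fin N) (Fin N) ℂ} (X0 : Ctx q d F h T)
include X0

lemma h_T : aeval (lf T) h = h := by
  apply MvPolynomial.funext
  intro x
  have h1 : eval x (aeval (lf T) h) = eval (T.mulVec x) h := by
    have h2 := eval_act T X x
    simp only [eval_X] at h2
    rw [← h2]
    change (eval x) ((aeval (lf T)) h) = eval (fun j => eval x (lf T j)) h
    generalize h = p
    induction p using MvPolynomial.induction_on with
    | C a => simp
    | add p q hp hq => simp only [map_add, hp, hq]
    | mul_X p i hp => simp only [map_mul, hp, aeval_X, eval_X]
  rw [h1]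
  have h3 : T.mulVec ((1 - T).mulVec x) = 0 := by
    rw [Matrix.mulVec_mulVec, mul_sub, X0.hT, mul_one, sub_self, Matrix.zero_mulVec]
  rw [← trans_inv ((X0.hker _).mp h3)]
  congr 2
  rw [Matrix.sub_mulVec, Matrix.one_mulVec]
  simp

lemma h_mem : h ∈ (LinearMap.range (ell ∘ₗ (LTm T).subtype)) ^ d := by
  rw [← X0.h_T]
  rw [aeval_def, eval₂_eq']
  refine Submodule.sum_mem _ fun m hm => ?_
  rw [← Algebra.smul_def]
  refine Submodule.smul_mem _ _ ?_
  have hd : ∑ i, m i = d := by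
    have := X0.hh (mem_support_iff.mp hm)
    rw [← this, Finsupp.weight_apply, Finsupp.sum_fintype _ _ (by simp)]
    simp
  rw [← hd]
  have hl : ∀ i, lf T i ∈ LinearMap.range (ell ∘ₗ (LTm T).subtype) := by
    intro i
    refine ⟨⟨T i, ?_⟩, rfl⟩
    have := congrFun X0.hT i
    rwa [Matrix.mul_apply_eq_vecMul] at this
  have key : ∀ s : Finset (Fin N), ∏ i ∈ s, lf T i ^ m i ∈
      (LinearMap.range (ell ∘ₗ (LTm T).subtype)) ^ (∑ i ∈ s, m i) := by
    classical
    intro s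
    induction s using Finset.induction_on with
    | empty =>
      rw [Finset.prod_empty, Finset.sum_empty, pow_zero]
      exact Submodule.one_le.mp le_rfl
    | insert a s ha ih =>
      rw [Finset.prod_insert ha, Finset.sum_insert ha, pow_add]
      exact Submodule.mul_mem_mul (Submodule.pow_mem_pow _ (hl a) _) ih
  exact key _

lemma exists_p (h0 : h ≠ 0) : ∃ m : Fin d → (Fin N → ℂ), (∀ i, m i ≠ 0) ∧
    ∀ e v, InM h e v → Dv v (∏ i, ell (m i)) = 0 := by
  have := X0.nilp
  obtain ⟨m, hm, hm2⟩ := weights (L := gg h T) (M := LTm T) (fun A => - Dv (lf A.1)) (ell ∘ₗ (LTm T).subtype) (by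
    intro A a
    show -(Dv (lf A.1) (ell a.1)) = ell (-(Matrix.vecMul a.1 A.1))
    rw [Dv_lf_ell, map_neg]) d h X0.h_mem h0 (by
      intro A
      show -(Dv (lf A.1) h) = 0
      rw [A.2.1, neg_zero])
  refine ⟨fun i => (m i).1, fun i hi => hm i (Subtype.ext hi), ?_⟩
  have hc : ∀ c : Fin N → ℂ, T.mulVec c = 0 → Dv (fun j => C (c j)) (∏ i, ell (m i).1) = 0 := by
    intro c hc
    have := der_prod (Dv (fun j => C (c j))) (fun i => ell (m i).1) 0 (by
      intro i
      rw [Dv_c_ell, ← (show Matrix.vecMul (m i).1 T = (m i).1 from (m i).2), ← Matrix.dotProduct_mulVec, hc]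
      simp) Finset.univ
    rw [this]; simp
  intro e v hv
  obtain ⟨lam, hinv⟩ := X0.hinv
  refine kill X0.hE X0.hq X0.hh hinv _ ?_ ?_ e hv
  · intro v hv
    choose c hcv using fun j => hom0 (hv.1 j)
    obtain rfl : v = fun j => C (c j) := funext hcv
    exact hc c ((X0.hker c).mpr hv.2)
  · intro v hv
    obtain ⟨A, rfl⟩ := hom1 hv.1
    rw [X0.DT _ _ hc]
    have h2 : act T (lf A) = lf (T * A) := by rw [lf, lf, act_mul]
    rw [h2]
    have h3 := hm2 ⟨T * A, X0.TBT hv.2⟩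
    exact neg_eq_zero.mp h3
end Ctx
end

section
lemma deg_one {N q d : ℕ} {F : Fin N → MvPolynomial (Fin N) ℂ} {h : MvPolynomial (Fin N) ℂ}
    (hE : IsEndo N q F) (hq : 2 ≤ q) (hh : h.IsHomogeneous d) {lam : ℂ} (hinv : aeval F h = C lam * h ^ q)
    (hirr : Irreducible h) : d = 1 ∧ ∃ i, pderiv i h ≠ 0 := by
  have h0 : h ≠ 0 := hirr.ne_zero
  have hd : d ≠ 0 := by
    rintro rfl
    obtain ⟨c, rfl⟩ := hom0 hh
    refine hirr.not_isUnit ((isUnit_iff_ne_zero.mpr ?_ : IsUnit c).map C)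
    rintro rfl
    exact h0 (map_zero _)
  have eul := hh.sum_X_mul_pderiv
  have hex : ∃ i, pderiv i h ≠ 0 := by
    by_contra! hcon
    simp only [hcon, mul_zero, Finset.sum_const_zero, nsmul_eq_mul] at eul
    rcases mul_eq_zero.mp eul.symm with h1 | h1
    · exact hd (by exact_mod_cast h1)
    · exact h0 h1
  refine ⟨?_, hex⟩
  obtain ⟨T, hT, hker⟩ := exists_T h
  have X0 : Ctx q d F h T := ⟨hE, hq, hh, ⟨lam, hinv⟩, hT, hker⟩
  obtain ⟨m, hm0, hm⟩ := X0.exists_p h0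
  set p := ∏ i, ell (m i) with hp
  have hph : p.IsHomogeneous d := by
    have := IsHomogeneous.prod Finset.univ (fun i => ell (m i)) (fun _ => 1) (fun i _ => ell_hom (m i))
    simpa using this
  have eulp := hph.sum_X_mul_pderiv
  have kos : ∀ a b, pderiv a h * pderiv b p = pderiv b h * pderiv a p := by
    intro a b
    have hD : ∀ r, Dv (Pi.single b (pderiv a h) - Pi.single a (pderiv b h)) r =
        pderiv a h * pderiv b r - pderiv b h * pderiv a r := by
      intro r
      rw [Dv_apply]
      simp [sub_mul, Finset.sum_sub_distrib, Pi.single_apply]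
    have := hm (d - 1) (Pi.single b (pderiv a h) - Pi.single a (pderiv b h)) ⟨?_, ?_⟩
    · rw [hD] at this
      exact sub_eq_zero.mp this
    · intro j
      refine IsHomogeneous.sub ?_ ?_
      · rw [Pi.single_apply]
        split_ifs
        · exact hh.pderiv
        · exact isHomogeneous_zero _ _ _
      · rw [Pi.single_apply]
        split_ifs
        · exact hh.pderiv
        · exact isHomogeneous_zero _ _ _
    · rw [hD]; ring
  obtain ⟨i, hi⟩ := hex
  have h1 : p * pderiv i h = h * pderiv i p := by
    have e1 : (d : MvPolynomial (Fin N) ℂ) * (p * pderiv i h) = d * (h * pderiv i p) := by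
      rw [nsmul_eq_mul] at eul eulp
      rw [← mul_assoc, ← mul_assoc, ← eul, ← eulp, Finset.sum_mul, Finset.sum_mul]
      refine Finset.sum_congr rfl fun j _ => ?_
      rw [mul_assoc, mul_assoc, mul_comm _ (pderiv i h), kos]
    exact mul_left_cancel₀ (by exact_mod_cast hd) e1
  have hpr : Prime h := hirr.prime
  have hdvd : h ∣ p := by
    rcases hpr.dvd_or_dvd (show h ∣ p * pderiv i h from ⟨_, h1⟩) with h2 | h2
    · exact h2
    · exfalso
      have := totalDegree_le_of_dvd_of_isDomain h2 hi
      rw [hh.totalDegree h0, hh.pderiv.totalDegree hi] at this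
      omega
  rw [hp, hpr.dvd_finset_prod_iff] at hdvd
  obtain ⟨k, -, hk⟩ := hdvd
  have := totalDegree_le_of_dvd_of_isDomain hk (ell_ne (hm0 k))
  rw [hh.totalDegree h0, (ell_hom (m k)).totalDegree (ell_ne (hm0 k))] at this
  omega
end

/-- **Theorem A.** If `X = {h = 0} ⊂ ℙⁿ` is an irreducible totally invariant hypersurface of
degree `d` whose singular locus has dimension `l` (with `l = -1` meaning smooth, encoded via
the Krull dimension of the Jacobian ring), then `(d-1)^(n-l-1) < binom(n, l+1)`. -/
theorem degree_bound (n : ℕ) (hn : 2 ≤ n) (d : ℕ) (h : MvPolynomial (Fin (n + 1)) ℂ)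
    (hirr : Irreducible h) (hhom : h.IsHomogeneous d)
    (hinv : IsTotallyInvariant (n + 1) h)
    (l : ℤ) (hl : -1 ≤ l)
    (hsmooth : l = -1 → ringKrullDim (MvPolynomial (Fin (n + 1)) ℂ ⧸ jacobianIdeal (n + 1) h) ≤ 0)
    (hsing : -1 < l → ringKrullDim (MvPolynomial (Fin (n + 1)) ℂ ⧸ jacobianIdeal (n + 1) h)
      = ((l + 1).toNat : WithBot ℕ∞)) :
    ((d : ℤ) - 1) ^ ((n : ℤ) - l - 1).toNat < (n.choose (l + 1).toNat : ℤ) := by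
  obtain ⟨q, hq, F, hE, lam, -, hinv⟩ := hinv
  obtain ⟨rfl, i, hi⟩ := deg_one hE hq hhom hinv hirr
  have htop : jacobianIdeal (n + 1) h = ⊤ := by
    obtain ⟨c, hc⟩ := hom0 (hhom.pderiv (i := i))
    refine Ideal.eq_top_of_isUnit_mem _ (x := pderiv i h)
      (Ideal.subset_span (Set.mem_insert_of_mem _ ⟨i, rfl⟩)) ?_
    rw [hc] at hi ⊢
    refine (isUnit_iff_ne_zero.mpr ?_ : IsUnit c).map C
    rintro rfl
    exact hi (map_zero _)
  rcases hl.lt_or_eq with hl' | rfl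
  · exfalso
    have h1 := hsing hl'
    have : Subsingleton (MvPolynomial (Fin (n + 1)) ℂ ⧸ jacobianIdeal (n + 1) h) :=
      Ideal.Quotient.subsingleton_iff.mpr htop
    rw [ringKrullDim_eq_bot_of_subsingleton] at h1
    exact WithBot.bot_ne_coe h1
  · have : ((n : ℤ) - -1 - 1).toNat = n := by omega
    rw [this]
    simp [show n ≠ 0 by omega]
end

section
/- Let k ≥ 1 and let h ∈ ℂ[X₀,…,X_k] be a nonconstant homogeneous polynomial such that the divisor X = {h = 0} ⊂ ℙᵏ(ℂ) is not totally invariant, i.e. for every endomorphism (G₀,…,G_k) of ℙᵏ of algebraic degree q ≥ 2 and every λ ∈ ℂ∖{0} one has h(G₀,…,G_k) ≠ λ·h^q. Then for every n ≥ k, the cone of ℙⁿ over X is not totally invariant: for every endomorphism (F₀,…,Fₙ) of ℙⁿ of algebraic degree q ≥ 2 and every λ ∈ ℂ∖{0}, one has h(F₀,…,F_k) ≠ λ·h^q, where h is regarded as an element of ℂ[X₀,…,Xₙ]. -/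
open MvPolynomial

theorem hc_mul_s1 {N q r : ℕ} {f g : MvPolynomial (Fin N) ℂ} (hf : f.IsHomogeneous q) :
    homogeneousComponent (q + r) (f * g) = f * homogeneousComponent r g := by
  have h1 : f * g = ∑ i ∈ Finset.range (g.totalDegree + 1), f * homogeneousComponent i g := by
    rw [← Finset.mul_sum, sum_homogeneousComponent]
  have h2 : ∀ i, homogeneousComponent (q + r) (f * homogeneousComponent i g) =
      if r = i then f * homogeneousComponent i g else 0 := by
    intro i
    rw [homogeneousComponent_of_mem ((mem_homogeneousSubmodule (q + i) _).2
      (hf.mul (homogeneousComponent_isHomogeneous i g)))]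
    simp
  rw [h1, map_sum, Finset.sum_congr rfl fun i _ => h2 i, Finset.sum_ite_eq]
  split_ifs with hr
  · rfl
  · rw [homogeneousComponent_eq_zero, mul_zero]
    simpa using hr

theorem fiber_finite {N q : ℕ} (hq : 1 ≤ q) (F : Fin N → MvPolynomial (Fin N) ℂ)
    (hF : IsEndo N q F) (c : Fin N → ℂ) :
    {z : Fin N → ℂ | ∀ i, eval z (F i) = c i}.Finite := by
  obtain ⟨hom, hz⟩ := hF
  set S := {z : Fin N → ℂ | ∀ i, eval z (F i) = c i} with hS
  set I : Ideal (MvPolynomial (Fin N) ℂ) := Ideal.span (Set.range F) with hI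
  have hrad : idealOfVars (Fin N) ℂ ≤ I.radical := by
    rw [← vanishingIdeal_zeroLocus_eq_radical (K := ℂ)]
    unfold idealOfVars
    rw [Ideal.span_le]
    rintro _ ⟨i, rfl⟩
    simp only [SetLike.mem_coe, mem_vanishingIdeal_iff]
    intro x hx
    have : x = 0 := hz x fun j => by
      have := hx (F j) (Ideal.subset_span ⟨j, rfl⟩)
      simpa [aeval_eq_eval] using this
    simp [this]
  obtain ⟨D, hD⟩ := Ideal.exists_pow_le_of_le_radical_of_fg hrad (idealOfVars_fg (Fin N) ℂ)
  let φ : MvPolynomial (Fin N) ℂ →ₐ[ℂ] (S → ℂ) :=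
    AlgHom.pi (fun z => aeval (z : Fin N → ℂ))
  have hφ : ∀ p (z : S), φ p z = eval (z : Fin N → ℂ) p := fun p z => by
    simp [φ, aeval_eq_eval]
  set V : Submodule ℂ (S → ℂ) := (restrictTotalDegree (Fin N) ℂ (D + q)).map φ.toLinearMap with hV
  have hhomV : ∀ m, ∀ p : MvPolynomial (Fin N) ℂ, p.IsHomogeneous m → φ p ∈ V := by
    intro m
    induction m using Nat.strong_induction_on with
    | _ m ih =>
      intro p hp
      by_cases hm : m ≤ D + q
      · exact ⟨p, (mem_restrictTotalDegree _ _ _).2 (hp.totalDegree_le.trans hm), rfl⟩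
      · have hpI : p ∈ I := by
          apply hD
          rw [mem_pow_idealOfVars_iff]
          intro x hx
          have := hp.degree_eq_sum_deg_support hx
          have h2 : x.degree = m := by
            by_contra hne
            exact (mem_support_iff.1 hx) (hp.coeff_eq_zero hne)
          simp only [Finsupp.degree] at *
          omega
        obtain ⟨g, hg⟩ := (Ideal.mem_span_range_iff_exists_fun).1 hpI
        obtain ⟨r, rfl⟩ : ∃ r, m = q + r := ⟨m - q, by omega⟩
        have hp2 : p = ∑ i, F i * homogeneousComponent r (g i) := by
          rw [← homogeneousComponent_eq_self hp, ← hg, map_sum]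
          refine Finset.sum_congr rfl fun i _ => ?_
          rw [mul_comm, hc_mul_s1 (hom i)]
        have : φ p = ∑ i, c i • φ (homogeneousComponent r (g i)) := by
          funext z
          rw [hφ, hp2]
          simp only [map_sum, map_mul, Finset.sum_apply, Pi.smul_apply, smul_eq_mul, hφ]
          exact Finset.sum_congr rfl fun i _ => by rw [z.2 i]
        rw [this]
        exact V.sum_mem fun i _ => V.smul_mem _
          (ih r (by omega) _ (homogeneousComponent_isHomogeneous _ _))
  have hall : ∀ p, φ p ∈ V := by
    intro p
    rw [← sum_homogeneousComponent p, map_sum]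
    exact V.sum_mem fun i _ => hhomV i _ (homogeneousComponent_isHomogeneous _ _)
  have hfin : Module.Finite ℂ V := Module.Finite.map _ _
  have hle : Subalgebra.toSubmodule φ.range ≤ V := by
    rintro _ ⟨p, rfl⟩
    exact hall p
  have hfin2 : Module.Finite ℂ φ.range :=
    (Submodule.finiteDimensional_of_le hle : FiniteDimensional ℂ (Subalgebra.toSubmodule φ.range))
  have hcoord : ∀ i : Fin N, ∃ P : Polynomial ℂ, P.Monic ∧ ∀ z ∈ S, P.eval (z i) = 0 := by
    intro i
    obtain ⟨P, hP, hP0⟩ := Algebra.IsIntegral.isIntegral (R := ℂ) (⟨φ (X i), X i, rfl⟩ : φ.range)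
    refine ⟨P, hP, fun z hz => ?_⟩
    rw [← Polynomial.aeval_def] at hP0
    have h1 : Polynomial.aeval (φ (X i)) P = 0 := by
      have := congrArg φ.range.val hP0
      rwa [← Polynomial.aeval_algHom_apply, map_zero] at this
    have h2 := congrArg (Pi.evalAlgHom ℂ (fun _ : S => ℂ) ⟨z, hz⟩) h1
    rw [← Polynomial.aeval_algHom_apply, map_zero] at h2
    simpa [hφ, Polynomial.aeval_def, Polynomial.eval₂_eq_eval_map] using h2
  choose P hPm hP using hcoord
  refine (Set.Finite.pi' (fun i => ((P i).roots.toFinset.finite_toSet))).subset ?_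
  intro z hz i
  simp only [Finset.mem_coe, Multiset.mem_toFinset]
  exact (Polynomial.mem_roots (hPm i).ne_zero).2 (hP i z hz)

theorem exists_form {m : ℕ} (S : Set (Fin (m + 1) → ℂ)) (hS : S.Finite) (h0 : ∀ z ∈ S, z ≠ 0) :
    ∃ a : Fin m → ℂ, ∀ z ∈ S, z (Fin.last m) ≠ ∑ i, a i * z i.castSucc := by
  let L : (Fin (m + 1) → ℂ) → MvPolynomial (Fin m) ℂ := fun z =>
    C (z (Fin.last m)) - ∑ i, X i * C (z i.castSucc)
  have hL : ∀ z a, eval a (L z) = z (Fin.last m) - ∑ i, a i * z i.castSucc := by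
    intro z a; simp [L]
  have hne : ∀ z ∈ S, L z ≠ 0 := by
    intro z hz hLz
    apply h0 z hz
    have hl : z (Fin.last m) = 0 := by
      have := hL z 0
      rw [hLz] at this
      simpa using this.symm
    funext j
    refine Fin.lastCases hl (fun i => ?_) j
    have := hL z (Pi.single i 1)
    rw [hLz] at this
    simpa [hl, Pi.single_apply] using this.symm
  have hprod : ∏ z ∈ hS.toFinset, L z ≠ 0 :=
    Finset.prod_ne_zero_iff.2 fun z hz => hne z (hS.mem_toFinset.1 hz)
  obtain ⟨a, ha⟩ : ∃ a, eval a (∏ z ∈ hS.toFinset, L z) ≠ 0 := by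
    by_contra! hcon
    exact hprod (MvPolynomial.funext fun a => by simpa using hcon a)
  refine ⟨a, fun z hz heq => ha ?_⟩
  rw [map_prod]
  exact Finset.prod_eq_zero (hS.mem_toFinset.2 hz) (by rw [hL, heq, sub_self])

theorem eval_smul_hom {N q : ℕ} {f : MvPolynomial (Fin N) ℂ} (hf : f.IsHomogeneous q)
    (t : ℂ) (w : Fin N → ℂ) : eval (t • w) f = t ^ q * eval w f := by
  rw [eval_eq, eval_eq, Finset.mul_sum]
  refine Finset.sum_congr rfl fun d hd => ?_
  have h2 : ∑ i, d i = q := by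
    rw [← Finsupp.degree_eq_sum]
    by_contra hne
    exact (mem_support_iff.1 hd) (hf.coeff_eq_zero hne)
  have h3 : ∑ i ∈ d.support, d i = q := by
    rw [← h2]
    exact Finset.sum_subset (Finset.subset_univ _) fun i _ hi => by simpa using hi
  simp only [Pi.smul_apply, smul_eq_mul, mul_pow, Finset.prod_mul_distrib,
    Finset.prod_pow_eq_pow_sum, h3]
  ring

theorem step {m q : ℕ} (hq : 1 ≤ q) (F : Fin (m + 1) → MvPolynomial (Fin (m + 1)) ℂ)
    (hF : IsEndo (m + 1) q F) : ∃ l : MvPolynomial (Fin m) ℂ,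
    IsEndo m q (fun i => aeval (Fin.snoc (α := fun _ => MvPolynomial (Fin m) ℂ) X l)
      (F i.castSucc)) := by
  have hfin := fiber_finite hq F hF (Pi.single (Fin.last m) 1)
  obtain ⟨a, ha⟩ := exists_form _ hfin (by
    rintro z hz rfl
    have := hz (Fin.last m)
    have h2 := eval_smul_hom (hF.1 (Fin.last m)) 0 0
    rw [smul_zero, this] at h2
    simp [show q ≠ 0 by omega] at h2)
  refine ⟨∑ i, C (a i) * X i, fun i => ?_, fun x hx => ?_⟩
  · rw [← one_mul q]
    refine (hF.1 _).aeval _ fun j => ?_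
    refine Fin.lastCases ?_ (fun i => ?_) j
    · rw [Fin.snoc_last]
      exact IsHomogeneous.sum _ _ _ fun i _ => isHomogeneous_C_mul_X _ _
    · rw [Fin.snoc_castSucc]
      exact isHomogeneous_X _ _
  · set w : Fin (m + 1) → ℂ := Fin.snoc (α := fun _ => ℂ) x (∑ i, a i * x i) with hw
    have hev : ∀ p : MvPolynomial (Fin (m + 1)) ℂ, eval x (aeval (Fin.snoc
        (α := fun _ => MvPolynomial (Fin m) ℂ) X (∑ i, C (a i) * X i)) p) = eval w p := by
      intro p
      rw [← aeval_eq_eval, ← aeval_eq_eval,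
        ← AlgHom.comp_apply]
      congr 1
      ext j
      refine Fin.lastCases ?_ (fun i => ?_) j
      · simp [hw]
      · simp [hw]
    by_contra hx0
    have hw0 : w ≠ 0 := by
      intro h
      apply hx0
      funext i
      have := congrFun h i.castSucc
      simpa [hw] using this
    have hFw : ∀ i : Fin m, eval w (F i.castSucc) = 0 := fun i => by
      rw [← hev]; exact hx i
    have hc : eval w (F (Fin.last m)) ≠ 0 := by
      intro h
      exact hw0 (hF.2 w fun j => Fin.lastCases h hFw j)
    obtain ⟨t, ht⟩ := IsAlgClosed.exists_pow_nat_eq (eval w (F (Fin.last m)))⁻¹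
      (show 0 < q by omega)
    refine ha (t • w) (fun j => ?_) ?_
    · rw [eval_smul_hom (hF.1 j)]
      refine Fin.lastCases ?_ (fun i => ?_) j
      · rw [ht, inv_mul_cancel₀ hc, Pi.single_eq_same]
      · rw [hFw, mul_zero, Pi.single_eq_of_ne (Fin.castSucc_lt_last i).ne]
    · simp only [hw, Pi.smul_apply, Fin.snoc_last, Fin.snoc_castSucc, smul_eq_mul, Finset.mul_sum]
      exact Finset.sum_congr rfl fun i _ => by ring

/-- **Theorem B.** If the divisor `X = {h = 0} ⊂ ℙᵏ` is not totally invariant, then for every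
`n ≥ k` the cone of `ℙⁿ` over `X` (defined by the same polynomial `h`, viewed in
`ℂ[X₀,…,Xₙ]`) is not totally invariant. -/
theorem cone_not_totally_invariant (k : ℕ) (hk : 1 ≤ k)
    (h : MvPolynomial (Fin (k + 1)) ℂ) (d : ℕ) (hd : d ≠ 0) (hne : h ≠ 0)
    (hhom : h.IsHomogeneous d)
    (hnotinv : ∀ q, 2 ≤ q → ∀ G : Fin (k + 1) → MvPolynomial (Fin (k + 1)) ℂ,
      IsEndo (k + 1) q G → ∀ lam : ℂ, lam ≠ 0 → aeval G h ≠ C lam * h ^ q) :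
    ∀ n, ∀ hkn : k ≤ n, ∀ q, 2 ≤ q → ∀ F : Fin (n + 1) → MvPolynomial (Fin (n + 1)) ℂ,
      IsEndo (n + 1) q F → ∀ lam : ℂ, lam ≠ 0 →
      aeval (fun i : Fin (k + 1) => F (Fin.castLE (Nat.succ_le_succ hkn) i)) h ≠
        C lam * (rename (Fin.castLE (Nat.succ_le_succ hkn)) h) ^ q := by
  intro n hkn
  induction n, hkn using Nat.le_induction with
  | base =>
    intro q hq F hF lam hlam heq
    refine hnotinv q hq F hF lam hlam ?_
    have e : (Fin.castLE (Nat.succ_le_succ (le_refl k)) : Fin (k + 1) → Fin (k + 1)) = id := by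
      funext i; rfl
    rw [e, rename_id_apply] at heq
    exact heq
  | succ n hkn ih =>
    intro q hq F hF lam hlam heq
    obtain ⟨l, hl⟩ := step (by omega : 1 ≤ q) F hF
    refine ih q hq _ hl lam hlam ?_
    have := congrArg (aeval (Fin.snoc (α := fun _ => MvPolynomial (Fin (n + 1)) ℂ) X l)) heq
    rw [map_mul, map_pow, aeval_rename, ← AlgHom.comp_apply, comp_aeval, aeval_C, algebraMap_eq] at this
    have e : (Fin.snoc (α := fun _ => MvPolynomial (Fin (n + 1)) ℂ) X l) ∘
        Fin.castLE (Nat.succ_le_succ (Nat.le_succ_of_le hkn)) =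
        X ∘ Fin.castLE (Nat.succ_le_succ hkn) := by
      funext i
      exact Fin.snoc_castSucc (α := fun _ => MvPolynomial (Fin (n + 1)) ℂ) l X
        (Fin.castLE (Nat.succ_le_succ hkn) i)
    rw [e, ← aeval_rename, aeval_X_left_apply] at this
    exact this
end
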